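/- Let D be a simply connected bounded domain in ℂ. Then D is a John disk if and only if there exists a constant c₂ ≥ 1 such that for all points z₁, z₂ ∈ D, m_D(z₁, z₂) ≤ c₂·j'_D(z₁, z₂). -/

import Mathlib

open Metric Set

variable {E : Type*} [NormedAddCommGroup E] [NormedSpace ℝ E]

/-- δ_D(z): the Euclidean distance from `z` to the boundary `∂D`. -/
noncomputable def bdist (D : Set E) (z : E) : ℝ := Metric.infDist z (frontier D)

/-- The m-density `m_D(z) = d(D) / (δ_D(z)·(d(D) − δ_D(z)))`. -/
noncomputable def mDensity (D : Set E) (z : E) : ℝ :=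
  Metric.diam D / (bdist D z * (Metric.diam D - bdist D z))

/-- A rectifiable path in `D` from `x` to `y`, modeled as a Lipschitz map on `[0,1]`. -/
def IsRectPathIn (D : Set E) (x y : E) (γ : ℝ → E) : Prop :=
  (∃ K : NNReal, LipschitzWith K γ) ∧ γ 0 = x ∧ γ 1 = y ∧ ∀ t ∈ Set.Icc (0:ℝ) 1, γ t ∈ D

/-- The line integral `∫_γ ρ(z) |dz|` of a density `ρ` along a path `γ`. -/
noncomputable def pathIntegral (ρ : E → ℝ) (γ : ℝ → E) : ℝ :=
  ∫ t in (0:ℝ)..1, ρ (γ t) * ‖deriv γ t‖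

/-- `inf_γ ∫_γ ρ(z)|dz|` over all rectifiable paths `γ` joining `x` and `y` in `D`. -/
noncomputable def pathDist (ρ : E → ℝ) (D : Set E) (x y : E) : ℝ :=
  sInf (pathIntegral ρ '' {γ | IsRectPathIn D x y γ})

/-- The metric `m_D`. -/
noncomputable def mDist (D : Set E) (x y : E) : ℝ := pathDist (mDensity D) D x y

/-- The quasihyperbolic metric `k_D`. -/
noncomputable def kDist (D : Set E) (x y : E) : ℝ :=
  pathDist (fun z => 1 / bdist D z) D x y

/-- The Euclidean length of the subarc of `γ` over the parameter interval `[s,t]`. -/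
noncomputable def subarcLength (γ : ℝ → E) (s t : ℝ) : ENNReal :=
  eVariationOn γ (Set.Icc s t)

/-- A bounded simply connected domain `D ⊂ ℂ` is a `c`-John disk (for some `c ≥ 1`):
each pair of points can be joined by a rectifiable arc `γ ⊂ D` satisfying the double
cone condition `min_j ℓ(γ(z_j, z)) ≤ c·δ_D(z)` for all `z ∈ γ`. -/
def IsJohnDisk (D : Set ℂ) : Prop :=
  ∃ c : ℝ, 1 ≤ c ∧ ∀ x ∈ D, ∀ y ∈ D, ∃ γ : ℝ → ℂ, IsRectPathIn D x y γ ∧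
    ∀ t ∈ Set.Icc (0:ℝ) 1,
      min (subarcLength γ 0 t) (subarcLength γ t 1)
        ≤ ENNReal.ofReal (c * bdist D (γ t))

/-- The inner distance $λ_D$: the infimum of Euclidean lengths of rectifiable paths
joining `x` and `y` in `D`. -/
noncomputable def innerDist (D : Set ℂ) (x y : ℂ) : ℝ :=
  pathDist (fun _ => 1) D x y

/-- The metric $j'_D$: the distance ratio metric with the Euclidean distance replaced
by the inner distance $λ_D$. -/
noncomputable def jDist' (D : Set ℂ) (x y : ℂ) : ℝ :=
  (1 / 2) * Real.log
    ((1 + innerDist D x y / bdist D x) * (1 + innerDist D x y / bdist D y))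

open Metric Set
open MeasureTheory Filter Topology

noncomputable def len (γ : ℝ → ℂ) (a b : ℝ) : ℝ := ∫ r in a..b, ‖deriv γ r‖

lemma measurable_nd {γ : ℝ → ℂ} : Measurable (fun r => ‖deriv γ r‖) :=
  (measurable_deriv γ).norm

lemma nd_le {K : NNReal} {γ : ℝ → ℂ} (h : LipschitzWith K γ) (r : ℝ) : ‖deriv γ r‖ ≤ K :=
  norm_deriv_le_of_lipschitz h

lemma nd_locInt {K : NNReal} {γ : ℝ → ℂ} (h : LipschitzWith K γ) :
    LocallyIntegrable (fun r => ‖deriv γ r‖) volume := by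
  have : LocallyIntegrable (fun _ : ℝ => (K:ℝ)) volume := locallyIntegrable_const _
  refine this.mono measurable_nd.aestronglyMeasurable (Eventually.of_forall fun r => ?_)
  simpa using nd_le h r

lemma nd_int {K : NNReal} {γ : ℝ → ℂ} (h : LipschitzWith K γ) (a b : ℝ) :
    IntervalIntegrable (fun r => ‖deriv γ r‖) volume a b :=
  ((nd_locInt h).integrableOn_isCompact isCompact_uIcc).intervalIntegrable

lemma len_add {K : NNReal} {γ : ℝ → ℂ} (h : LipschitzWith K γ) (a b c : ℝ) :
    len γ a b + len γ b c = len γ a c :=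
  intervalIntegral.integral_add_adjacent_intervals (nd_int h a b) (nd_int h b c)

lemma len_nonneg {γ : ℝ → ℂ} {a b : ℝ} (hab : a ≤ b) : 0 ≤ len γ a b :=
  intervalIntegral.integral_nonneg hab fun _ _ => norm_nonneg _

lemma len_self (γ : ℝ → ℂ) (a : ℝ) : len γ a a = 0 := by simp [len]

lemma len_lip {K : NNReal} {γ : ℝ → ℂ} (h : LipschitzWith K γ) (a : ℝ) :
    LipschitzWith K (fun r => len γ a r) := by
  refine LipschitzWith.of_dist_le_mul fun x y => ?_
  have h1 : len γ a x - len γ a y = len γ y x := by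
    have := len_add h a y x; linarith
  rw [Real.dist_eq, h1, Real.dist_eq]
  have := intervalIntegral.norm_integral_le_of_norm_le_const (a := y) (b := x)
    (f := fun r => ‖deriv γ r‖) (C := K) (fun r _ => by simpa using nd_le h r)
  simpa [len] using this

lemma len_ae_deriv {K : NNReal} {γ : ℝ → ℂ} (h : LipschitzWith K γ) (a : ℝ) :
    ∀ᵐ r, HasDerivAt (fun r => len γ a r) ‖deriv γ r‖ r := by
  filter_upwards [LocallyIntegrable.ae_hasDerivAt_integral (nd_locInt h)] with r hr
  exact hr a

lemma dist_le_len {K : NNReal} {γ : ℝ → ℂ} (h : LipschitzWith K γ) {a b : ℝ} (hab : a ≤ b) :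
    ‖γ b - γ a‖ ≤ len γ a b := by
  set w := γ b - γ a with hw
  by_cases hw0 : w = 0
  · rw [hw0, norm_zero]; exact len_nonneg hab
  let φ : ℂ →L[ℝ] ℝ := Complex.reCLM.comp ((ContinuousLinearMap.mul ℝ ℂ) (starRingEnd ℂ w))
  have hφ : ∀ z, φ z = (starRingEnd ℂ w * z).re := fun z => rfl
  have hφn : ∀ z, φ z ≤ ‖w‖ * ‖z‖ := by
    intro z
    rw [hφ]
    refine (Complex.re_le_norm _).trans ?_
    simp
  have hL : LipschitzWith (‖φ‖₊ * K) (φ ∘ γ) := φ.lipschitz.comp h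
  have hAC := (hL.lipschitzOnWith (s := uIcc a b)).absolutelyContinuousOnInterval
  have h1 := hAC.integral_deriv_eq_sub
  have h2 : (φ ∘ γ) b - (φ ∘ γ) a = ‖w‖ * ‖w‖ := by
    simp only [Function.comp]
    rw [← map_sub, hφ, ← hw, mul_comm, Complex.mul_conj, Complex.ofReal_re, Complex.normSq_eq_norm_sq]
    ring
  have h3 : ∫ x in a..b, deriv (φ ∘ γ) x ≤ ∫ x in a..b, ‖w‖ * ‖deriv γ x‖ := by
    apply intervalIntegral.integral_mono_ae hab hAC.intervalIntegrable_deriv ((nd_int h a b).const_mul _)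
    filter_upwards [h.ae_differentiableAt_real] with x hx
    have : HasDerivAt (φ ∘ γ) (φ (deriv γ x)) x := φ.hasFDerivAt.comp_hasDerivAt x hx.hasDerivAt
    rw [this.deriv]
    exact hφn _
  rw [intervalIntegral.integral_const_mul, h1, h2] at h3
  exact le_of_mul_le_mul_left h3 (norm_pos_iff.2 hw0)

lemma evar_le_len {K : NNReal} {γ : ℝ → ℂ} (h : LipschitzWith K γ) {a b : ℝ} :
    eVariationOn γ (Icc a b) ≤ ENNReal.ofReal (len γ a b) := by
  refine iSup_le ?_
  rintro ⟨n, u, hu, hus⟩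
  have h1 : ∀ m, ∑ i ∈ Finset.range m, edist (γ (u (i + 1))) (γ (u i)) ≤
      ENNReal.ofReal (len γ (u 0) (u m)) := by
    intro m
    induction m with
    | zero => simp
    | succ m ih =>
      rw [Finset.sum_range_succ, ← len_add h (u 0) (u m) (u (m+1)),
        ENNReal.ofReal_add (len_nonneg (hu (Nat.zero_le _))) (len_nonneg (hu (Nat.le_succ _)))]
      gcongr
      rw [edist_dist, dist_eq_norm]
      exact ENNReal.ofReal_le_ofReal (dist_le_len h (hu (Nat.le_succ _)))
  refine (h1 n).trans (ENNReal.ofReal_le_ofReal ?_)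
  have e1 := len_add h a (u 0) (u n)
  have e2 := len_add h a (u n) b
  have := len_nonneg (γ := γ) (hus 0).1
  have := len_nonneg (γ := γ) (hus n).2
  linarith

lemma len_le_evar {K : NNReal} {γ : ℝ → ℂ} (h : LipschitzWith K γ) {a b : ℝ} (hab : a ≤ b) :
    ENNReal.ofReal (len γ a b) ≤ eVariationOn γ (Icc a b) := by
  have hlb : LocallyBoundedVariationOn γ univ := h.locallyBoundedVariationOn univ
  set V : ℝ → ℝ := fun t => variationOnFromTo γ univ a t with hV
  have hsub : ∀ x y, x ≤ y → V y - V x = (eVariationOn γ (Icc x y)).toReal := by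
    intro x y hxy
    have := variationOnFromTo.add hlb (mem_univ a) (mem_univ x) (mem_univ y)
    have h2 := variationOnFromTo.eq_of_le γ univ hxy
    rw [univ_inter] at h2
    rw [← h2]; simp only [hV]; linarith
  have hfin : ∀ x y, eVariationOn γ (Icc x y) ≠ ⊤ := by
    intro x y
    have := hlb x y (mem_univ _) (mem_univ _)
    rwa [BoundedVariationOn, univ_inter] at this
  have hlow : ∀ x y, x ≤ y → ‖γ y - γ x‖ ≤ V y - V x := by
    intro x y hxy
    rw [hsub x y hxy, ← dist_eq_norm]
    have := eVariationOn.edist_le γ (right_mem_Icc.2 hxy) (left_mem_Icc.2 hxy)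
    rw [edist_dist] at this
    exact (ENNReal.ofReal_le_iff_le_toReal (hfin x y)).1 this
  have hup : ∀ x y, x ≤ y → V y - V x ≤ K * (y - x) := by
    intro x y hxy
    rw [hsub x y hxy]
    have h1 := evar_le_len h (a := x) (b := y)
    have h2 : len γ x y ≤ K * (y - x) := by
      have := (len_lip h x).dist_le_mul y x
      rw [Real.dist_eq, Real.dist_eq, len_self, sub_zero, abs_of_nonneg (len_nonneg hxy),
        abs_of_nonneg (sub_nonneg.2 hxy)] at this
      exact this
    refine (ENNReal.toReal_mono ENNReal.ofReal_ne_top h1).trans ?_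
    rw [ENNReal.toReal_ofReal (len_nonneg hxy)]; exact h2
  have hVL : LipschitzWith K V := by
    refine LipschitzWith.of_dist_le_mul fun x y => ?_
    rw [Real.dist_eq, Real.dist_eq]
    rcases le_total x y with hxy | hxy
    · have := hlow x y hxy
      have h3 := norm_nonneg (γ y - γ x)
      rw [abs_sub_comm, abs_of_nonneg (by linarith), abs_sub_comm, abs_of_nonneg (by linarith)]
      exact hup x y hxy
    · have := hlow y x hxy
      have h3 := norm_nonneg (γ x - γ y)
      rw [abs_of_nonneg (by linarith), abs_of_nonneg (by linarith)]
      exact hup y x hxy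
  have hAC := (hVL.lipschitzOnWith (s := uIcc a b)).absolutelyContinuousOnInterval
  have h1 := hAC.integral_deriv_eq_sub
  have h3 : len γ a b ≤ ∫ x in a..b, deriv V x := by
    apply intervalIntegral.integral_mono_ae hab (nd_int h a b) hAC.intervalIntegrable_deriv
    filter_upwards [h.ae_differentiableAt_real, hVL.ae_differentiableAt_real] with x hx hx'
    have t1 := (hasDerivAt_iff_tendsto_slope.1 hx.hasDerivAt).norm
    have t2 := hasDerivAt_iff_tendsto_slope.1 hx'.hasDerivAt
    refine le_of_tendsto_of_tendsto t1 t2 (eventually_of_mem self_mem_nhdsWithin ?_)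
    intro y hy
    simp only [slope, vsub_eq_sub, smul_eq_mul, norm_smul, norm_inv, Real.norm_eq_abs]
    rcases le_total x y with hxy | hxy
    · rw [abs_of_nonneg (by linarith)]
      exact mul_le_mul_of_nonneg_left (hlow x y hxy) (inv_nonneg.2 (by linarith))
    · rw [abs_of_nonpos (by linarith), norm_sub_rev]
      have := mul_le_mul_of_nonneg_left (hlow y x hxy) (inv_nonneg.2 (show 0 ≤ -(y - x) by linarith))
      refine this.trans (le_of_eq ?_)
      rw [inv_neg]; ring
  rw [h1, hsub a b hab] at h3
  exact (ENNReal.ofReal_le_iff_le_toReal (hfin a b)).2 h3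

lemma log_integral {K : NNReal} {S : ℝ → ℝ} (h : LipschitzWith K S) {A s t : ℝ} (hA : 0 < A)
    (hst : s ≤ t) (hS : ∀ r ∈ Icc s t, A ≤ S r) :
    ∫ r in s..t, deriv S r / S r = Real.log (S t) - Real.log (S s) := by
  have hL : LipschitzOnWith (K / A.toNNReal) (fun r => Real.log (S r)) (uIcc s t) := by
    rw [uIcc_of_le hst]
    have key : ∀ x ∈ Icc s t, ∀ y ∈ Icc s t, Real.log (S x) - Real.log (S y) ≤ K / A * |x - y| := by
      intro x hx y hy
      have hx' := hA.trans_le (hS x hx)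
      have hy' := hA.trans_le (hS y hy)
      rw [← Real.log_div hx'.ne' hy'.ne']
      have h1 := Real.log_le_sub_one_of_pos (div_pos hx' hy')
      have h2 : S x / S y - 1 = (S x - S y) / S y := by field_simp
      have h3 := h.dist_le_mul x y
      rw [Real.dist_eq, Real.dist_eq] at h3
      have h4 : (S x - S y) / S y ≤ |S x - S y| / A := by
        refine (div_le_div_of_nonneg_right (le_abs_self _) hy'.le).trans ?_
        exact div_le_div_of_nonneg_left (abs_nonneg _) hA (hS y hy)
      have h5 : |S x - S y| / A ≤ K * |x - y| / A := div_le_div_of_nonneg_right h3 hA.le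
      calc _ ≤ _ := h1
        _ = _ := h2
        _ ≤ _ := h4.trans h5
        _ = _ := by ring
    refine LipschitzOnWith.of_dist_le_mul fun x hx y hy => ?_
    rw [Real.dist_eq, Real.dist_eq, abs_le]
    have e1 := key x hx y hy
    have e2 := key y hy x hx
    rw [abs_sub_comm] at e2
    constructor
    · rw [NNReal.coe_div, Real.coe_toNNReal _ hA.le]; linarith
    · rw [NNReal.coe_div, Real.coe_toNNReal _ hA.le]; linarith
  rw [← hL.absolutelyContinuousOnInterval.integral_deriv_eq_sub]
  apply intervalIntegral.integral_congr_ae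
  filter_upwards [h.ae_differentiableAt_real] with x hx hx'
  have hx'' : x ∈ Icc s t := by rw [← uIcc_of_le hst]; exact uIoc_subset_uIcc hx'
  exact ((hx.hasDerivAt.log (hA.trans_le (hS x hx'')).ne').deriv).symm

lemma log_len_right {K : NNReal} {γ : ℝ → ℂ} (h : LipschitzWith K γ) {A s t : ℝ} (hA : 0 < A)
    (hst : s ≤ t) :
    ∫ r in s..t, ‖deriv γ r‖ / (A + len γ s r) = Real.log ((A + len γ s t) / A) := by
  have hL : LipschitzWith (0 + K) (fun r => A + len γ s r) := (LipschitzWith.const A).add (len_lip h s)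
  have := log_integral hL hA hst (fun r hr => by have := len_nonneg (γ := γ) hr.1; linarith)
  rw [len_self, add_zero, ← Real.log_div (by have := len_nonneg (γ := γ) hst; linarith) hA.ne'] at this
  rw [← this]
  apply intervalIntegral.integral_congr_ae
  filter_upwards [len_ae_deriv h s] with x hx _
  rw [(hx.const_add A).deriv]

lemma log_len_left {K : NNReal} {γ : ℝ → ℂ} (h : LipschitzWith K γ) {A s t : ℝ} (hA : 0 < A)
    (hst : s ≤ t) :
    ∫ r in s..t, ‖deriv γ r‖ / (A + len γ r t) = Real.log ((A + len γ s t) / A) := by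
  have e : ∀ r, len γ r t = len γ s t - len γ s r := fun r => by
    have := len_add h s r t; linarith
  have hL : LipschitzWith (0 + K) (fun r => (A + len γ s t) - len γ s r) :=
    (LipschitzWith.const _).sub (len_lip h s)
  have := log_integral hL hA hst (fun r hr => by
    have := len_nonneg (γ := γ) hr.2; rw [e] at this; linarith)
  rw [len_self, sub_zero, add_sub_cancel_right] at this
  have h2 : 0 < A + len γ s t := by have := len_nonneg (γ := γ) hst; linarith
  rw [Real.log_div h2.ne' hA.ne', ← neg_sub, ← this, ← intervalIntegral.integral_neg]
  apply intervalIntegral.integral_congr_ae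
  filter_upwards [len_ae_deriv h s] with x hx _
  rw [(hx.const_sub _).deriv, e, neg_div, neg_neg, add_sub_assoc]

open Metric Set
open MeasureTheory Filter Topology


noncomputable def cat (γ₁ γ₂ : ℝ → ℂ) (t : ℝ) : ℂ :=
  γ₁ (min (2 * t) 1) + γ₂ (max (2 * t - 1) 0) - γ₁ 1

lemma cat_left {γ₁ γ₂ : ℝ → ℂ} (h : γ₁ 1 = γ₂ 0) {t : ℝ} (ht : t ≤ 1 / 2) :
    cat γ₁ γ₂ t = γ₁ (2 * t) := by
  rw [cat, min_eq_left (by linarith), max_eq_right (by linarith), h]; ring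

lemma cat_right {γ₁ γ₂ : ℝ → ℂ} {t : ℝ} (ht : 1 / 2 ≤ t) :
    cat γ₁ γ₂ t = γ₂ (2 * t - 1) := by
  rw [cat, min_eq_right (by linarith), max_eq_left (by linarith)]; ring

lemma lip_mul (c d : ℝ) : ∃ K : NNReal, LipschitzWith K (fun t : ℝ => c * t + d) := by
  refine ⟨‖c‖₊, LipschitzWith.of_dist_le_mul fun x y => ?_⟩
  rw [Real.dist_eq, Real.dist_eq, show c * x + d - (c * y + d) = c * (x - y) by ring, abs_mul]
  simp

lemma cat_lip {γ₁ γ₂ : ℝ → ℂ} (h₁ : ∃ K : NNReal, LipschitzWith K γ₁)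
    (h₂ : ∃ K : NNReal, LipschitzWith K γ₂) : ∃ K : NNReal, LipschitzWith K (cat γ₁ γ₂) := by
  obtain ⟨K₁, h₁⟩ := h₁
  obtain ⟨K₂, h₂⟩ := h₂
  obtain ⟨K₃, h₃⟩ := lip_mul 2 0
  obtain ⟨K₄, h₄⟩ := lip_mul 2 (-1)
  simp only [add_zero, ← sub_eq_add_neg] at h₃ h₄
  exact ⟨_, ((h₁.comp (h₃.min_const 1)).add (h₂.comp (h₄.max_const 0))).sub
    (LipschitzWith.const (γ₁ 1))⟩

lemma deriv_affine (γ : ℝ → ℂ) (c d t : ℝ) :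
    deriv (fun r => γ (c * r + d)) t = c • deriv γ (c * t + d) := by
  have h1 := deriv_comp_mul_left c (fun r => γ (r + d)) t
  rw [deriv_comp_add_const] at h1
  exact h1

lemma integral_affine (ρ : ℂ → ℝ) (γ : ℝ → ℂ) {c : ℝ} (hc : 0 ≤ c) (d a b : ℝ) :
    ∫ t in a..b, ρ (γ (c * t + d)) * ‖deriv (fun r => γ (c * r + d)) t‖ =
    ∫ t in (c * a + d)..(c * b + d), ρ (γ t) * ‖deriv γ t‖ := by
  rw [← intervalIntegral.mul_integral_comp_mul_add, ← intervalIntegral.integral_const_mul]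
  congr 1
  ext t
  rw [deriv_affine, norm_smul, Real.norm_of_nonneg hc]; ring

lemma rect_sub {D : Set ℂ} {γ : ℝ → ℂ} (hγ : ∃ K : NNReal, LipschitzWith K γ) {a b : ℝ}
    (hab : a ≤ b) (hD : ∀ t ∈ Icc a b, γ t ∈ D) (ρ : ℂ → ℝ) :
    IsRectPathIn D (γ a) (γ b) (fun r => γ ((b - a) * r + a)) ∧
    pathIntegral ρ (fun r => γ ((b - a) * r + a)) = ∫ t in a..b, ρ (γ t) * ‖deriv γ t‖ := by
  obtain ⟨K, hK⟩ := hγ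
  obtain ⟨K', hK'⟩ := lip_mul (b - a) a
  refine ⟨⟨⟨_, hK.comp hK'⟩, by simp, by simp, fun t ht => hD _ ⟨?_, ?_⟩⟩, ?_⟩
  · nlinarith [ht.1, ht.2]
  · nlinarith [ht.1, ht.2]
  · rw [pathIntegral, integral_affine ρ γ (sub_nonneg.2 hab)]; simp

lemma rect_symm {D : Set ℂ} {x y : ℂ} {γ : ℝ → ℂ} (h : IsRectPathIn D x y γ) (ρ : ℂ → ℝ) :
    IsRectPathIn D y x (fun r => γ (1 - r)) ∧
    pathIntegral ρ (fun r => γ (1 - r)) = pathIntegral ρ γ := by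
  obtain ⟨⟨K, hK⟩, h0, h1, hm⟩ := h
  obtain ⟨K', hK'⟩ := lip_mul (-1) 1
  refine ⟨⟨⟨K * K', ?_⟩, by simpa using h1, by simpa using h0, fun t ht => hm _ ⟨?_, ?_⟩⟩, ?_⟩
  · have := hK.comp hK'
    convert this using 2 with r
    simp only [Function.comp]; congr 1; ring
  · linarith [ht.2]
  · linarith [ht.1]
  · rw [pathIntegral, pathIntegral]
    have : ∀ t, deriv (fun r => γ (1 - r)) t = - deriv γ (1 - t) := fun t => deriv_comp_const_sub γ 1 t
    simp only [this, norm_neg]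
    rw [intervalIntegral.integral_comp_sub_left (fun t => ρ (γ t) * ‖deriv γ t‖)]
    simp

lemma rect_cat {D : Set ℂ} {x y z : ℂ} {γ₁ γ₂ : ℝ → ℂ} (h₁ : IsRectPathIn D x y γ₁)
    (h₂ : IsRectPathIn D y z γ₂) : IsRectPathIn D x z (cat γ₁ γ₂) := by
  obtain ⟨hK, h0, h1, hm⟩ := h₁
  obtain ⟨hK', h0', h1', hm'⟩ := h₂
  have e : γ₁ 1 = γ₂ 0 := by rw [h1, h0']
  refine ⟨cat_lip hK hK', ?_, ?_, fun t ht => ?_⟩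
  · rw [cat_left e (by norm_num)]; simpa using h0
  · rw [cat_right (by norm_num)]; norm_num; exact h1'
  · rcases le_total t (1/2) with h | h
    · rw [cat_left e h]; exact hm _ ⟨by linarith [ht.1], by linarith⟩
    · rw [cat_right h]; exact hm' _ ⟨by linarith, by linarith [ht.2]⟩

lemma rho_int {D : Set ℂ} {ρ : ℂ → ℝ} (hρ : ContinuousOn ρ D) {γ : ℝ → ℂ}
    (hγ : ∃ K : NNReal, LipschitzWith K γ) {a b : ℝ}
    (hD : ∀ t ∈ uIcc a b, γ t ∈ D) :
    IntervalIntegrable (fun t => ρ (γ t) * ‖deriv γ t‖) volume a b := by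
  obtain ⟨K, hK⟩ := hγ
  exact (nd_int hK a b).continuousOn_mul (hρ.comp hK.continuous.continuousOn hD)

lemma cat_integral {D : Set ℂ} {x y z : ℂ} {ρ : ℂ → ℝ} (hρ : ContinuousOn ρ D) {γ₁ γ₂ : ℝ → ℂ}
    (h₁ : IsRectPathIn D x y γ₁) (h₂ : IsRectPathIn D y z γ₂) :
    pathIntegral ρ (cat γ₁ γ₂) = pathIntegral ρ γ₁ + pathIntegral ρ γ₂ := by
  have h := rect_cat h₁ h₂
  have e : γ₁ 1 = γ₂ 0 := by rw [h₁.2.2.1, h₂.2.1]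
  rw [pathIntegral, ← intervalIntegral.integral_add_adjacent_intervals (b := 1/2)
    (rho_int hρ h.1 (fun t ht => h.2.2.2 t ?_)) (rho_int hρ h.1 (fun t ht => h.2.2.2 t ?_))]
  · congr 1
    · have := integral_affine ρ γ₁ (c := 2) (by norm_num) 0 0 (1/2)
      norm_num at this
      rw [pathIntegral]
      norm_num
      rw [← this]
      apply intervalIntegral.integral_congr_ae
      filter_upwards [compl_mem_ae_iff.2 (measure_singleton (1/2 : ℝ))] with t ht ht'
      rw [uIoc_of_le (by norm_num)] at ht'
      have hlt : t < 1/2 := lt_of_le_of_ne ht'.2 (by simpa using ht)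
      have hev : cat γ₁ γ₂ =ᶠ[𝓝 t] fun r => γ₁ (2 * r) := by
        filter_upwards [Iio_mem_nhds hlt] with r hr using cat_left e (le_of_lt hr)
      rw [hev.deriv_eq, cat_left e hlt.le]
    · have := integral_affine ρ γ₂ (c := 2) (by norm_num) (-1) (1/2) 1
      norm_num at this
      rw [pathIntegral]
      norm_num
      rw [← this]
      apply intervalIntegral.integral_congr_ae
      filter_upwards with t ht'
      rw [uIoc_of_le (by norm_num)] at ht'
      have hlt : 1/2 < t := ht'.1
      have hev : cat γ₁ γ₂ =ᶠ[𝓝 t] fun r => γ₂ (2 * r + -1) := by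
        filter_upwards [Ioi_mem_nhds hlt] with r hr
        rw [cat_right (le_of_lt hr)]; rfl
      rw [hev.deriv_eq, cat_right hlt.le]; rfl
  · rw [uIcc_of_le (by norm_num)] at ht; exact ⟨ht.1, by linarith [ht.2]⟩
  · rw [uIcc_of_le (by norm_num)] at ht; exact ⟨by linarith [ht.1], ht.2⟩


lemma pathIntegral_nonneg {D : Set ℂ} {ρ : ℂ → ℝ} (h0 : ∀ z ∈ D, 0 ≤ ρ z) {x y : ℂ} {γ : ℝ → ℂ}
    (h : IsRectPathIn D x y γ) : 0 ≤ pathIntegral ρ γ :=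
  intervalIntegral.integral_nonneg zero_le_one
    fun t ht => mul_nonneg (h0 _ (h.2.2.2 t ht)) (norm_nonneg _)

lemma pd_le {D : Set ℂ} {ρ : ℂ → ℝ} (h0 : ∀ z ∈ D, 0 ≤ ρ z) {x y : ℂ} {γ : ℝ → ℂ}
    (h : IsRectPathIn D x y γ) : pathDist ρ D x y ≤ pathIntegral ρ γ := by
  refine csInf_le ⟨0, ?_⟩ ⟨γ, h, rfl⟩
  rintro _ ⟨γ', h', rfl⟩
  exact pathIntegral_nonneg h0 h'

lemma pd_sub_le {D : Set ℂ} {ρ : ℂ → ℝ} (h0 : ∀ z ∈ D, 0 ≤ ρ z) {γ : ℝ → ℂ}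
    (hγ : ∃ K : NNReal, LipschitzWith K γ) {a b : ℝ}
    (hab : a ≤ b) (hD : ∀ t ∈ Icc a b, γ t ∈ D) :
    pathDist ρ D (γ a) (γ b) ≤ ∫ t in a..b, ρ (γ t) * ‖deriv γ t‖ := by
  obtain ⟨h1, h2⟩ := rect_sub hγ hab hD ρ
  exact (pd_le h0 h1).trans h2.le

lemma exists_near {D : Set ℂ} {ρ : ℂ → ℝ} {x y : ℂ} (hne : ∃ γ, IsRectPathIn D x y γ)
    {M : ℝ} (hM : pathDist ρ D x y < M) : ∃ γ, IsRectPathIn D x y γ ∧ pathIntegral ρ γ < M := by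
  obtain ⟨γ, hγ⟩ := hne
  obtain ⟨_, ⟨γ', h', rfl⟩, h2⟩ := exists_lt_of_csInf_lt (s := pathIntegral ρ '' {γ | IsRectPathIn D x y γ})
    ⟨_, γ, hγ, rfl⟩ hM
  exact ⟨γ', h', h2⟩

lemma pd_symm {D : Set ℂ} {ρ : ℂ → ℝ} (x y : ℂ) : pathDist ρ D x y = pathDist ρ D y x := by
  have : ∀ x y, pathIntegral ρ '' {γ | IsRectPathIn D x y γ} ⊆ pathIntegral ρ '' {γ | IsRectPathIn D y x γ} := by
    rintro x y _ ⟨γ, h, rfl⟩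
    obtain ⟨h1, h2⟩ := rect_symm h ρ
    exact ⟨_, h1, h2⟩
  rw [pathDist, pathDist, (this x y).antisymm (this y x)]

lemma pd_nonneg {D : Set ℂ} {ρ : ℂ → ℝ} (h0 : ∀ z ∈ D, 0 ≤ ρ z) (x y : ℂ) : 0 ≤ pathDist ρ D x y := by
  apply Real.sInf_nonneg
  rintro _ ⟨γ, h, rfl⟩
  exact pathIntegral_nonneg h0 h

lemma pd_triangle {D : Set ℂ} {ρ : ℂ → ℝ} (h0 : ∀ z ∈ D, 0 ≤ ρ z) (hρ : ContinuousOn ρ D)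
    (hc : ∀ x ∈ D, ∀ y ∈ D, ∃ γ, IsRectPathIn D x y γ)
    {x y z : ℂ} (hx : x ∈ D) (hy : y ∈ D) (hz : z ∈ D) :
    pathDist ρ D x z ≤ pathDist ρ D x y + pathDist ρ D y z := by
  refine le_of_forall_pos_le_add fun ε hε => ?_
  obtain ⟨γ₁, h₁, e₁⟩ := exists_near (ρ := ρ) (hc x hx y hy) (lt_add_of_pos_right _ (half_pos hε))
  obtain ⟨γ₂, h₂, e₂⟩ := exists_near (ρ := ρ) (hc y hy z hz) (lt_add_of_pos_right _ (half_pos hε))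
  have := pd_le h0 (rect_cat h₁ h₂)
  rw [cat_integral hρ h₁ h₂] at this
  linarith

lemma rect_seg {D : Set ℂ} {x y : ℂ} (h : segment ℝ x y ⊆ D) :
    IsRectPathIn D x y (fun t : ℝ => x + t • (y - x)) := by
  refine ⟨⟨‖y - x‖₊, LipschitzWith.of_dist_le_mul fun s t => ?_⟩, by simp, by simp, fun t ht => h ?_⟩
  · rw [dist_add_left, dist_eq_norm, ← sub_smul, norm_smul, mul_comm]; rfl
  · rw [segment_eq_image']; exact ⟨t, ht, rfl⟩

lemma pd_seg {D : Set ℂ} {ρ : ℂ → ℝ} (h0 : ∀ z ∈ D, 0 ≤ ρ z) (hρ : ContinuousOn ρ D) {x y : ℂ}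
    (h : segment ℝ x y ⊆ D) {M : ℝ} (hM : ∀ z ∈ segment ℝ x y, ρ z ≤ M) :
    pathDist ρ D x y ≤ M * ‖y - x‖ := by
  have hr := rect_seg h
  refine (pd_le h0 hr).trans ?_
  have hd : ∀ t, deriv (fun t : ℝ => x + t • (y - x)) t = y - x := by
    intro t
    have : HasDerivAt (fun t : ℝ => x + t • (y - x)) ((1:ℝ) • (y - x)) t :=
      ((hasDerivAt_id t).smul_const (y - x)).const_add x
    simpa using this.deriv
  have : pathIntegral ρ (fun t : ℝ => x + t • (y - x)) ≤ ∫ t in (0:ℝ)..1, M * ‖y - x‖ := by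
    apply intervalIntegral.integral_mono_on zero_le_one
    · exact rho_int hρ hr.1 (fun t ht => hr.2.2.2 t (by rwa [uIcc_of_le zero_le_one] at ht))
    · exact intervalIntegrable_const
    · intro t ht
      rw [hd]
      refine mul_le_mul_of_nonneg_right (hM _ ?_) (norm_nonneg _)
      rw [segment_eq_image']; exact ⟨t, ht, rfl⟩
  simpa using this


lemma frontier_ne {D : Set ℂ} (hb : Bornology.IsBounded D) (hne : D.Nonempty) :
    (frontier D).Nonempty := by
  rw [nonempty_frontier_iff]
  refine ⟨hne, fun h => ?_⟩
  rw [h] at hb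
  exact NoncompactSpace.noncompact_univ (X := ℂ) (by simpa using hb.isCompact_closure)

lemma bdist_pos {D : Set ℂ} (ho : IsOpen D) (hb : Bornology.IsBounded D) {z : ℂ} (hz : z ∈ D) :
    0 < bdist D z := by
  rw [bdist, ← isClosed_frontier.notMem_iff_infDist_pos (frontier_ne hb ⟨z, hz⟩)]
  rw [ho.frontier_eq]
  exact fun h => h.2 hz

lemma bdist_lip (D : Set ℂ) (z w : ℂ) : bdist D z ≤ bdist D w + ‖z - w‖ := by
  rw [← dist_eq_norm]; exact infDist_le_infDist_add_dist

lemma bdist_cont (D : Set ℂ) : Continuous (bdist D) := continuous_infDist_pt _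

lemma ball_bdist {D : Set ℂ} (ho : IsOpen D) {z : ℂ} (hz : z ∈ D) :
    ball z (bdist D z) ⊆ D := by
  intro w hw
  by_contra hwD
  have hconn : IsPreconnected (segment ℝ z w) := (convex_segment z w).isPreconnected
  have hfr : ((segment ℝ z w) ∩ frontier D).Nonempty := by
    by_contra hcon
    have h1 : segment ℝ z w ⊆ D := by
      have := hconn.subset_or_subset ho (isClosed_closure (s := D)).isOpen_compl
        (disjoint_left.2 fun a ha hb => hb (subset_closure ha)) (fun a ha => by
          by_contra hc
          simp only [mem_union, mem_compl_iff, not_or, not_not] at hc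
          exact hcon ⟨a, ha, by rw [ho.frontier_eq]; exact ⟨hc.2, hc.1⟩⟩)
      rcases this with h | h
      · exact h
      · exact absurd (subset_closure hz) (h (left_mem_segment ℝ z w))
    exact hwD (h1 (right_mem_segment ℝ z w))
  obtain ⟨a, ha, haf⟩ := hfr
  have h1 : bdist D z ≤ dist z a := infDist_le_dist_of_mem haf
  have h2 : dist z a ≤ dist z w := by
    have := (convex_closedBall z (dist z w)).segment_subset (mem_closedBall_self dist_nonneg)
      (by simp [dist_comm]) ha
    simpa [dist_comm] using this
  rw [mem_ball, dist_comm] at hw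
  linarith

lemma two_bdist_le {D : Set ℂ} (ho : IsOpen D) (hb : Bornology.IsBounded D) {z : ℂ} (hz : z ∈ D) :
    2 * bdist D z ≤ Metric.diam D := by
  have hp := bdist_pos ho hb hz
  refine le_of_forall_lt fun c hc => ?_
  obtain ⟨r, hr0, hr1, hr2⟩ : ∃ r, 0 < r ∧ c < 2 * r ∧ r < bdist D z :=
    ⟨(max (c/2) 0 + bdist D z) / 2, by
      have := le_max_right (c/2) 0; linarith, by
      have := le_max_left (c/2) 0; linarith, by
      have := max_lt (show c/2 < bdist D z by linarith) hp; linarith⟩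
  have h1 : z + r ∈ D := ball_bdist ho hz (by simp [abs_of_pos hr0, hr2])
  have h2 : z - r ∈ D := ball_bdist ho hz (by simp [dist_eq_norm, abs_of_pos hr0, hr2])
  have := dist_le_diam_of_mem hb h1 h2
  rw [dist_eq_norm, show z + r - (z - r) = ((2 * r : ℝ) : ℂ) by push_cast; ring, Complex.norm_real,
    Real.norm_of_nonneg (by linarith)] at this
  linarith

lemma mDensity_ge {D : Set ℂ} (ho : IsOpen D) (hb : Bornology.IsBounded D) {z : ℂ} (hz : z ∈ D) :
    1 / bdist D z ≤ mDensity D z := by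
  have hp := bdist_pos ho hb hz
  have h2 := two_bdist_le ho hb hz
  rw [mDensity, div_le_div_iff₀ hp (mul_pos hp (by linarith))]
  nlinarith

lemma mDensity_le {D : Set ℂ} (ho : IsOpen D) (hb : Bornology.IsBounded D) {z : ℂ} (hz : z ∈ D) :
    mDensity D z ≤ 2 / bdist D z := by
  have hp := bdist_pos ho hb hz
  have h2 := two_bdist_le ho hb hz
  rw [mDensity, div_le_div_iff₀ (mul_pos hp (by linarith)) hp]
  nlinarith

lemma mDensity_nonneg {D : Set ℂ} (ho : IsOpen D) (hb : Bornology.IsBounded D) :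
    ∀ z ∈ D, 0 ≤ mDensity D z := fun z hz =>
  (one_div_pos.2 (bdist_pos ho hb hz)).le.trans (mDensity_ge ho hb hz)

lemma mDensity_cont {D : Set ℂ} (ho : IsOpen D) (hb : Bornology.IsBounded D) :
    ContinuousOn (mDensity D) D := by
  unfold mDensity
  refine continuousOn_const.div ((bdist_cont D).mul (continuous_const.sub (bdist_cont D))).continuousOn ?_
  intro z hz
  have hp := bdist_pos ho hb hz
  have h2 := two_bdist_le ho hb hz
  exact (mul_pos hp (by linarith)).ne'

lemma rect_exists {D : Set ℂ} (ho : IsOpen D) (hb : Bornology.IsBounded D) (hc : IsConnected D) :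
    ∀ x ∈ D, ∀ y ∈ D, ∃ γ, IsRectPathIn D x y γ := by
  intro x hx y hy
  refine hc.isPreconnected.induction₂ (fun x y => ∃ γ, IsRectPathIn D x y γ) ?_ ?_ ?_ hx hy
  · intro x hx
    filter_upwards [mem_nhdsWithin_of_mem_nhds (ball_mem_nhds x (bdist_pos ho hb hx))] with y hy
    exact ⟨_, rect_seg (((convex_ball x _).segment_subset
      (mem_ball_self (bdist_pos ho hb hx)) hy).trans (ball_bdist ho hx))⟩
  · rintro x y z - - - ⟨γ, h⟩ ⟨γ', h'⟩
    exact ⟨_, rect_cat h h'⟩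
  · rintro x y - - ⟨γ, h⟩
    exact ⟨_, (rect_symm h (fun _ => 0)).1⟩

lemma pathIntegral_one (γ : ℝ → ℂ) : pathIntegral (fun _ => 1) γ = len γ 0 1 := by
  simp [pathIntegral, len]

lemma innerDist_sub_le {D : Set ℂ} {γ : ℝ → ℂ}
    (hγ : ∃ K : NNReal, LipschitzWith K γ) {a b : ℝ}
    (hab : a ≤ b) (hD : ∀ t ∈ Icc a b, γ t ∈ D) :
    innerDist D (γ a) (γ b) ≤ len γ a b := by
  have := pd_sub_le (ρ := fun _ => 1) (by simp) hγ hab hD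
  simpa [len, innerDist] using this

lemma innerDist_nonneg (D : Set ℂ) (x y : ℂ) : 0 ≤ innerDist D x y := pd_nonneg (by simp) x y

lemma dist_le_innerDist {D : Set ℂ} {x y : ℂ} (hne : ∃ γ, IsRectPathIn D x y γ) :
    ‖y - x‖ ≤ innerDist D x y := by
  obtain ⟨γ, hγ⟩ := hne
  refine le_csInf ⟨_, γ, hγ, rfl⟩ ?_
  rintro _ ⟨γ', ⟨⟨K, hK⟩, h0, h1, -⟩, rfl⟩
  rw [pathIntegral_one, ← h0, ← h1]
  exact dist_le_len hK zero_le_one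

open Metric Set
open MeasureTheory Filter Topology

lemma div_int {K : NNReal} {γ : ℝ → ℂ} (hγ : LipschitzWith K γ) {f : ℝ → ℝ} (hf : Continuous f)
    {a b : ℝ} (hab : a ≤ b) (hpos : ∀ t ∈ Icc a b, 0 < f t) :
    IntervalIntegrable (fun u => ‖deriv γ u‖ / f u) volume a b := by
  have : ContinuousOn (fun u => (f u)⁻¹) (uIcc a b) := by
    rw [uIcc_of_le hab]
    exact hf.continuousOn.inv₀ fun t ht => (hpos t ht).ne'
  have := (nd_int hγ a b).continuousOn_mul this
  refine this.congr ?_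
  intro x _
  simp [div_eq_inv_mul]

lemma first_time {f : ℝ → ℝ} (hf : Continuous f) {a b A : ℝ} (hab : a ≤ b) (ha : f a ≤ A)
    (hb : A ≤ f b) : ∃ r ∈ Icc a b, f r = A ∧ ∀ u ∈ Icc a r, f u ≤ A := by
  have hc : IsCompact (Icc a b ∩ {u | A ≤ f u}) :=
    isCompact_Icc.inter_right (isClosed_le continuous_const hf)
  obtain ⟨r, ⟨hr, hrA⟩, hmin⟩ := hc.exists_isLeast ⟨b, ⟨hab, le_rfl⟩, hb⟩
  obtain ⟨r', hr', e⟩ := intermediate_value_Icc hr.1 hf.continuousOn ⟨ha, hrA⟩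
  have h1 : r ≤ r' := hmin ⟨⟨hr'.1, hr'.2.trans hr.2⟩, e.ge⟩
  have h2 : r = r' := le_antisymm h1 hr'.2
  refine ⟨r, hr, h2 ▸ e, fun u hu => ?_⟩
  by_contra hcon
  push Not at hcon
  have := hmin ⟨⟨hu.1, hu.2.trans hr.2⟩, hcon.le⟩
  have : u = r := le_antisymm hu.2 this
  rw [this, h2, e] at hcon
  exact lt_irrefl _ hcon

lemma carrot {K : NNReal} {γ : ℝ → ℂ} (hγ : LipschitzWith K γ) {f : ℝ → ℝ} (hf : Continuous f)
    (hpos : ∀ t ∈ Icc (0:ℝ) 1, 0 < f t) (hlip : ∀ s t, s ≤ t → f s ≤ f t + len γ s t)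
    (hmax : ∀ t ∈ Icc (0:ℝ) 1, f t ≤ f 1) {C0 C' : ℝ} (hC0 : 0 ≤ C0)
    (hloc : ∀ r t A, 0 ≤ r → r ≤ t → t ≤ 1 → 0 < A → (∀ u ∈ Icc r t, f u ≤ A) → A / 2 ≤ f r →
      A / 2 ≤ f t → len γ r t ≤ C0 * A ∧ ∫ u in r..t, ‖deriv γ u‖ / f u ≤ C') :
    ∀ t ∈ Icc (0:ℝ) 1, len γ 0 t ≤ 3 * C0 * Real.exp C' * f t := by
  have hrec : ∀ n : ℕ, ∀ t ∈ Icc (0:ℝ) 1, (∀ u ∈ Icc 0 t, f u ≤ f t) → f t ≤ 2 ^ n * f 0 →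
      len γ 0 t ≤ 2 * C0 * f t := by
    intro n
    induction n with
    | zero =>
      intro t ht hu h
      have hp := hpos t ht
      have := (hloc 0 t (f t) le_rfl ht.1 ht.2 hp hu (by simp at h; linarith) (by linarith)).1
      nlinarith
    | succ n ih =>
      intro t ht hu h
      have hp := hpos t ht
      by_cases h0 : f t / 2 ≤ f 0
      · have := (hloc 0 t (f t) le_rfl ht.1 ht.2 hp hu h0 (by linarith)).1
        nlinarith
      · push Not at h0
        obtain ⟨r, hr, hrA, hru⟩ := first_time hf ht.1 h0.le (by linarith)
        have h1 := ih r ⟨hr.1, hr.2.trans ht.2⟩ (by rwa [hrA]) (by rw [hrA]; rw [pow_succ] at h; linarith)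
        have h2 := (hloc r t (f t) hr.1 hr.2 ht.2 hp (fun u hu' => hu u ⟨hr.1.trans hu'.1, hu'.2⟩)
          hrA.ge (by linarith)).1
        have := len_add hγ 0 r t
        rw [hrA] at h1
        nlinarith
  intro t ht
  obtain ⟨s, hs, hsm⟩ := isCompact_Icc.exists_isMaxOn (nonempty_Icc.2 ht.1) (hf.continuousOn (s := Icc 0 t))
  have hsm : ∀ u ∈ Icc 0 t, f u ≤ f s := fun u hu => hsm hu
  have hs1 : s ∈ Icc (0:ℝ) 1 := ⟨hs.1, hs.2.trans ht.2⟩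
  have hps := hpos s hs1
  have hpt := hpos t ht
  have hp0 := hpos 0 ⟨le_rfl, zero_le_one⟩
  obtain ⟨n, hn⟩ : ∃ n : ℕ, f s / f 0 < 2 ^ n := pow_unbounded_of_one_lt _ (by norm_num)
  have h1 := hrec n s hs1 (fun u hu => hsm u ⟨hu.1, hu.2.trans hs.2⟩) ((div_lt_iff₀ hp0).1 hn).le
  obtain ⟨r, hr, hrA, hru⟩ := first_time hf ht.2 (hsm t ⟨ht.1, le_rfl⟩) (hmax s hs1)
  have hsr : s ≤ r := hs.2.trans hr.1
  obtain ⟨h2, h3⟩ := hloc s r (f s) hs.1 hsr hr.2 hps (fun u hu => by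
    rcases le_total u t with h | h
    · exact hsm u ⟨hs.1.trans hu.1, h⟩
    · exact hru u ⟨h, hu.2⟩) (by linarith) (by linarith)
  have hI1 := div_int hγ hf hs.2 (fun u hu => hpos u ⟨hs.1.trans hu.1, hu.2.trans ht.2⟩)
  have hI2 := div_int hγ hf hr.1 (fun u hu => hpos u ⟨ht.1.trans hu.1, hu.2.trans hr.2⟩)
  have h4 : ∫ u in s..t, ‖deriv γ u‖ / f u ≤ C' := by
    rw [← intervalIntegral.integral_add_adjacent_intervals hI1 hI2] at h3
    have : 0 ≤ ∫ u in t..r, ‖deriv γ u‖ / f u := intervalIntegral.integral_nonneg hr.1 fun u hu =>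
      div_nonneg (norm_nonneg _) (hpos u ⟨ht.1.trans hu.1, hu.2.trans hr.2⟩).le
    linarith
  have hcl : Continuous (fun r => f t + len γ r t) := by
    have e : ∀ r, len γ r t = len γ 0 t - len γ 0 r := fun r => by
      have := len_add hγ 0 r t; linarith
    rw [show (fun r => f t + len γ r t) = fun r => f t + (len γ 0 t - len γ 0 r) from funext fun r => by rw [e r]]
    exact continuous_const.add (continuous_const.sub (len_lip hγ 0).continuous)
  have h5 : Real.log ((f t + len γ s t) / f t) ≤ C' := by
    rw [← log_len_left hγ hpt hs.2]
    refine le_trans (intervalIntegral.integral_mono_on hs.2 (div_int hγ hcl hs.2 ?_) hI1 ?_) h4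
    · intro u hu
      have := len_nonneg (γ := γ) hu.2
      linarith
    · intro u hu
      exact div_le_div_of_nonneg_left (norm_nonneg _)
        (hpos u ⟨hs.1.trans hu.1, hu.2.trans ht.2⟩) (hlip u t hu.2)
  have h6 := len_nonneg (γ := γ) hs.2
  have h7 : f s ≤ Real.exp C' * f t := by
    rw [Real.log_le_iff_le_exp (by positivity), div_le_iff₀ hpt] at h5
    exact (hlip s t hs.2).trans h5
  have h8 := len_add hγ 0 s t
  have h9 := len_add hγ s t r
  have h10 := len_nonneg (γ := γ) hr.1
  have : len γ 0 t ≤ 3 * C0 * f s := by linarith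
  nlinarith

lemma log_bound {c : ℝ} (hc : 1 ≤ c) {v : ℝ} (hv : 0 ≤ v) (h : v ≤ c * Real.log (1 + 2 * v) + 1) :
    v ≤ 5 / 2 + 2 * c * Real.log (4 * c) := by
  have h1 : Real.log (1 + 2 * v) ≤ (1 + 2 * v) / (4 * c) - 1 + Real.log (4 * c) := by
    have := Real.log_le_sub_one_of_pos (x := (1 + 2 * v) / (4 * c)) (by positivity)
    rw [Real.log_div (by positivity) (by positivity)] at this
    linarith
  have h2 : c * Real.log (1 + 2 * v) ≤ c * ((1 + 2 * v) / (4 * c) - 1 + Real.log (4 * c)) :=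
    mul_le_mul_of_nonneg_left h1 (by linarith)
  have h3 : c * ((1 + 2 * v) / (4 * c) - 1 + Real.log (4 * c)) =
      (1 + 2 * v) / 4 - c + c * Real.log (4 * c) := by
    field_simp
  linarith

lemma john_of_le {D : Set ℂ} (ho : IsOpen D) (hcn : IsConnected D) (hb : Bornology.IsBounded D)
    {c : ℝ} (hc : 1 ≤ c) (H : ∀ x ∈ D, ∀ y ∈ D, mDist D x y ≤ c * jDist' D x y) : IsJohnDisk D := by
  have hne := rect_exists ho hb hcn
  have hr0 := mDensity_nonneg ho hb
  have hrc := mDensity_cont ho hb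
  -- center
  obtain ⟨z0, hz0, hz0m⟩ : ∃ z0 ∈ D, ∀ z ∈ D, bdist D z ≤ bdist D z0 := by
    obtain ⟨w, hw⟩ := hcn.nonempty
    obtain ⟨z0, hz0, hm⟩ := (hb.isCompact_closure).exists_isMaxOn ⟨w, subset_closure hw⟩
      (bdist_cont D).continuousOn
    refine ⟨z0, ?_, fun z hz => hm (subset_closure hz)⟩
    by_contra hcon
    have h1 : bdist D z0 = 0 := infDist_zero_of_mem (by rw [ho.frontier_eq]; exact ⟨hz0, hcon⟩)
    have h2 : bdist D w ≤ bdist D z0 := hm (subset_closure hw)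
    have := bdist_pos ho hb hw
    linarith
  set C0 := 5 / 2 + 2 * c * Real.log (4 * c) with hC0
  have hlog0 : 0 ≤ Real.log (4 * c) := Real.log_nonneg (by linarith)
  have hC0p : 0 ≤ C0 := by positivity
  set C' := c * Real.log (1 + 2 * C0) + 1 with hC'
  have one : ∀ x ∈ D, ∃ γ, IsRectPathIn D x z0 γ ∧ ∀ t ∈ Icc (0:ℝ) 1,
      len γ 0 t ≤ 3 * C0 * Real.exp C' * bdist D (γ t) := by
    intro x hx
    obtain ⟨γ, hγ, hlt⟩ := exists_near (ρ := mDensity D) (hne x hx z0 hz0) (lt_add_one _)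
    refine ⟨γ, hγ, ?_⟩
    obtain ⟨⟨K, hK⟩, e0, e1, hm⟩ := hγ
    have hf : Continuous (fun t => bdist D (γ t)) := (bdist_cont D).comp hK.continuous
    refine carrot hK hf (fun t ht => bdist_pos ho hb (hm t ht)) ?_ ?_ hC0p ?_
    · intro s t hst
      have := bdist_lip D (γ s) (γ t)
      have h2 := dist_le_len hK hst
      rw [norm_sub_rev] at h2
      linarith
    · intro t ht
      rw [e1]; exact hz0m _ (hm t ht)
    · intro r t A hr hrt ht hA hu hrA htA
      have hsub : ∀ u ∈ Icc r t, γ u ∈ D := fun u hu => hm u ⟨hr.trans hu.1, hu.2.trans ht⟩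
      have hi : ∀ a b, 0 ≤ a → a ≤ b → b ≤ 1 →
          IntervalIntegrable (fun t => mDensity D (γ t) * ‖deriv γ t‖) volume a b := by
        intro a b ha hab hb'
        refine rho_int hrc ⟨K, hK⟩ fun u hu => ?_
        rw [uIcc_of_le hab] at hu
        exact hm u ⟨ha.trans hu.1, hu.2.trans hb'⟩
      have hmr := hsub r ⟨le_rfl, hrt⟩
      have hmt := hsub t ⟨hrt, le_rfl⟩
      have hm1 : ∫ u in r..t, mDensity D (γ u) * ‖deriv γ u‖ ≤ mDist D (γ r) (γ t) + 1 := by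
        have a1 : mDist D x (γ r) ≤ ∫ u in (0:ℝ)..r, mDensity D (γ u) * ‖deriv γ u‖ := by
          rw [← e0]
          exact pd_sub_le hr0 ⟨K, hK⟩ hr fun u hu => hm u ⟨hu.1, hu.2.trans (hrt.trans ht)⟩
        have a2 : mDist D (γ t) z0 ≤ ∫ u in t..(1:ℝ), mDensity D (γ u) * ‖deriv γ u‖ := by
          rw [← e1]
          exact pd_sub_le hr0 ⟨K, hK⟩ ht fun u hu => hm u ⟨(hr.trans hrt).trans hu.1, hu.2⟩
        have a3 : mDist D x z0 ≤ mDist D x (γ r) + mDist D (γ r) z0 :=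
          pd_triangle hr0 hrc hne hx hmr hz0
        have a4 : mDist D (γ r) z0 ≤ mDist D (γ r) (γ t) + mDist D (γ t) z0 :=
          pd_triangle hr0 hrc hne hmr hmt hz0
        have a5 : (∫ u in (0:ℝ)..r, mDensity D (γ u) * ‖deriv γ u‖) +
          (∫ u in r..t, mDensity D (γ u) * ‖deriv γ u‖) +
          (∫ u in t..(1:ℝ), mDensity D (γ u) * ‖deriv γ u‖) = pathIntegral (mDensity D) γ := by
          rw [intervalIntegral.integral_add_adjacent_intervals (hi 0 r le_rfl hr (hrt.trans ht))
            (hi r t hr hrt ht), intervalIntegral.integral_add_adjacent_intervals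
            (hi 0 t le_rfl (hr.trans hrt) ht) (hi t 1 (hr.trans hrt) ht le_rfl)]
          rfl
        have a6 : pathIntegral (mDensity D) γ < mDist D x z0 + 1 := hlt
        linarith
      have hI := div_int hK hf hrt (fun u hu => bdist_pos ho hb (hsub u hu))
      have hm2 : ∫ u in r..t, ‖deriv γ u‖ / bdist D (γ u) ≤
          ∫ u in r..t, mDensity D (γ u) * ‖deriv γ u‖ := by
        refine intervalIntegral.integral_mono_on hrt hI (hi r t hr hrt ht) fun u hu => ?_
        have := mul_le_mul_of_nonneg_right (mDensity_ge ho hb (hsub u hu)) (norm_nonneg (deriv γ u))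
        rwa [one_div_mul_eq_div] at this
      have hm3 : len γ r t / A ≤ ∫ u in r..t, ‖deriv γ u‖ / bdist D (γ u) := by
        rw [len, ← intervalIntegral.integral_div]
        refine intervalIntegral.integral_mono_on hrt ((nd_int hK r t).div_const A) hI fun u hu' => ?_
        exact div_le_div_of_nonneg_left (norm_nonneg _) (bdist_pos ho hb (hsub u hu')) (hu u hu')
      have hl0 := len_nonneg (γ := γ) hrt
      have hin := innerDist_sub_le ⟨K, hK⟩ hrt hsub
      have hin0 := innerDist_nonneg D (γ r) (γ t)
      set v := len γ r t / A with hv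
      have hv0 : 0 ≤ v := by positivity
      have hA1 : ∀ z, z ∈ D → A / 2 ≤ bdist D z → innerDist D (γ r) (γ t) / bdist D z ≤ 2 * v := by
        intro z hz hzA
        calc innerDist D (γ r) (γ t) / bdist D z ≤ len γ r t / (A / 2) :=
              div_le_div₀ hl0 hin (by positivity) hzA
          _ = 2 * v := by rw [hv]; field_simp
      have hj : jDist' D (γ r) (γ t) ≤ Real.log (1 + 2 * v) := by
        have b1 := hA1 _ hmr hrA
        have b2 := hA1 _ hmt htA
        have b3 : 0 ≤ innerDist D (γ r) (γ t) / bdist D (γ r) :=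
          div_nonneg hin0 (bdist_pos ho hb hmr).le
        have b4 : 0 ≤ innerDist D (γ r) (γ t) / bdist D (γ t) :=
          div_nonneg hin0 (bdist_pos ho hb hmt).le
        have : Real.log ((1 + innerDist D (γ r) (γ t) / bdist D (γ r)) *
            (1 + innerDist D (γ r) (γ t) / bdist D (γ t))) ≤ Real.log ((1 + 2 * v) ^ 2) := by
          apply Real.log_le_log (by positivity)
          rw [sq]
          gcongr
        rw [Real.log_pow] at this
        rw [jDist']
        push_cast at this
        linarith
      have hH := H _ hmr _ hmt
      have hj2 := mul_le_mul_of_nonneg_left hj (by linarith : (0:ℝ) ≤ c)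
      have hvC : v ≤ C0 := log_bound hc hv0 (by linarith)
      constructor
      · rw [hv, div_le_iff₀ hA] at hvC; exact hvC
      · have : Real.log (1 + 2 * v) ≤ Real.log (1 + 2 * C0) :=
          Real.log_le_log (by positivity) (by linarith)
        have := mul_le_mul_of_nonneg_left this (by linarith : (0:ℝ) ≤ c)
        linarith
  set b := 3 * C0 * Real.exp C' with hbdef
  have hb0 : 0 ≤ b := by positivity
  refine ⟨max 1 b, le_max_left _ _, fun x hx y hy => ?_⟩
  obtain ⟨γ₁, h₁, k₁⟩ := one x hx
  obtain ⟨γ₂, h₂, k₂⟩ := one y hy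
  have h₂' := (rect_symm h₂ (fun _ => 0)).1
  have hcat := rect_cat h₁ h₂'
  refine ⟨_, hcat, fun t ht => ?_⟩
  have e : γ₁ 1 = (fun r => γ₂ (1 - r)) 0 := by rw [h₁.2.2.1, h₂'.2.1]
  obtain ⟨K₁, hK₁⟩ := h₁.1
  obtain ⟨K₂, hK₂⟩ := h₂.1
  have key : ∀ w ∈ D, ∀ l, l ≤ b * bdist D w → ENNReal.ofReal l ≤ ENNReal.ofReal (max 1 b * bdist D w) := by
    intro w hw l hl
    apply ENNReal.ofReal_le_ofReal
    exact hl.trans (mul_le_mul_of_nonneg_right (le_max_right _ _) (bdist_pos ho hb hw).le)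
  rcases le_total t (1/2) with h | h
  · refine (min_le_left _ _).trans ?_
    have hin : 2 * t ∈ Icc (0:ℝ) 1 := ⟨by linarith [ht.1], by linarith⟩
    rw [cat_left e h]
    refine le_trans ?_ (key _ (h₁.2.2.2 _ hin) _ (k₁ (2 * t) hin))
    refine le_trans ?_ (evar_le_len hK₁)
    rw [subarcLength]
    have : EqOn (cat γ₁ (fun r => γ₂ (1 - r))) (γ₁ ∘ fun r => 2 * r) (Icc 0 t) := fun u hu =>
      cat_left e (hu.2.trans h)
    rw [eVariationOn.congr this]
    refine eVariationOn.comp_le_of_monotoneOn _ _ (fun a _ b _ hab => by simpa using hab) fun u hu => ⟨?_, ?_⟩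
    · linarith [hu.1]
    · linarith [hu.2]
  · refine (min_le_right _ _).trans ?_
    have hin : 2 - 2 * t ∈ Icc (0:ℝ) 1 := ⟨by linarith [ht.2], by linarith⟩
    rw [cat_right h, show 1 - (2 * t - 1) = 2 - 2 * t by ring]
    refine le_trans ?_ (key _ (h₂.2.2.2 _ hin) _ (k₂ (2 - 2 * t) hin))
    refine le_trans ?_ (evar_le_len hK₂)
    rw [subarcLength]
    have : EqOn (cat γ₁ (fun r => γ₂ (1 - r))) (γ₂ ∘ fun r => 2 - 2 * r) (Icc t 1) := fun u hu => by
      rw [cat_right (h.trans hu.1)]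
      show γ₂ _ = γ₂ _
      congr 1; ring
    rw [eVariationOn.congr this]
    refine eVariationOn.comp_le_of_antitoneOn _ _ (fun a _ b _ hab => by show 2 - 2 * b ≤ 2 - 2 * a; linarith) fun u hu => ⟨?_, ?_⟩
    · linarith [hu.2]
    · linarith [hu.1]

open Metric Set
open MeasureTheory Filter Topology

lemma exp_const {S : Set ℂ} (hS : IsPreconnected S) {g : ℂ → ℂ} (hg : ContinuousOn g S) {k : ℂ}
    (he : ∀ z ∈ S, Complex.exp (g z) = k) {a b : ℂ} (ha : a ∈ S) (hb : b ∈ S) : g a = g b := by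
  have := Complex.isCoveringMap_exp.eqOn_of_comp_eqOn hS hg (continuousOn_const (c := g a))
    (fun z hz => by
      apply Subtype.ext
      show Complex.exp (g z) = Complex.exp (g a)
      rw [he z hz, he a ha]) ha rfl
  exact (this hb).symm

noncomputable def linc (q p p' : ℂ) : ℂ := Complex.log ((p' - q) / (p - q))

lemma linc_half {q p p' : ℂ} (c : ℂ) (hp : 0 < (c * (p - q)).re) (hp' : 0 < (c * (p' - q)).re) :
    linc q p p' = Complex.log (c * (p' - q)) - Complex.log (c * (p - q)) := by
  have hx : c * (p - q) ≠ 0 := fun h => by simp [h] at hp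
  have hx' : c * (p' - q) ≠ 0 := fun h => by simp [h] at hp'
  have a1 := abs_lt.1 (Complex.abs_arg_lt_pi_div_two_iff.2 (Or.inl hp))
  have a2 := abs_lt.1 (Complex.abs_arg_lt_pi_div_two_iff.2 (Or.inl hp'))
  have hc : c ≠ 0 := left_ne_zero_of_mul hx
  have hpi := Real.pi_pos
  have hne : (c * (p - q)).arg ≠ Real.pi := by linarith
  rw [linc, show (p' - q) / (p - q) = (c * (p' - q)) * (c * (p - q))⁻¹ by
    have := right_ne_zero_of_mul hx
    field_simp, (Complex.log_mul_eq_add_log_iff hx' (inv_ne_zero hx)).2, Complex.log_inv _ hne, ← sub_eq_add_neg]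
  rw [Complex.arg_inv, if_neg hne]
  constructor <;> linarith

lemma linc_branch {q p p' : ℂ} {g : ℂ → ℂ} (hg : ContinuousOn g (segment ℝ p p'))
    (he : ∀ z ∈ segment ℝ p p', Complex.exp (g z) = z - q) (hd : ‖p' - p‖ < ‖p - q‖) :
    linc q p p' = g p' - g p := by
  have hpq : p - q ≠ 0 := by
    intro h; rw [h, norm_zero] at hd; exact absurd (norm_nonneg (p' - p)) (by linarith)
  have hsl : ∀ z ∈ segment ℝ p p', (z - q) / (p - q) ∈ Complex.slitPlane := by
    intro z hz
    have h1 : ‖z - p‖ < ‖p - q‖ := by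
      obtain ⟨t, ht, rfl⟩ := (segment_eq_image' ℝ p p').subset hz
      simp only [add_sub_cancel_left, norm_smul, Real.norm_of_nonneg ht.1]
      nlinarith [norm_nonneg (p' - p), ht.2]
    have : (z - q) / (p - q) = 1 + (z - p) / (p - q) := by field_simp; ring
    rw [this]
    apply Complex.mem_slitPlane_of_norm_lt_one
    rw [norm_div, div_lt_one (by linarith [norm_nonneg (z - p)])]
    exact h1
  have hk : ∀ z ∈ segment ℝ p p',
      Complex.exp (g z - Complex.log ((z - q) / (p - q))) = p - q := by
    intro z hz
    have h0 := Complex.slitPlane_ne_zero (hsl z hz)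
    rw [Complex.exp_sub, he z hz, Complex.exp_log h0]
    have : z - q ≠ 0 := fun h => h0 (by rw [h, zero_div])
    field_simp
  have := exp_const (convex_segment p p').isPreconnected
    (g := fun z => g z - Complex.log ((z - q) / (p - q))) (hg.sub (ContinuousOn.clog (by fun_prop) hsl)) hk
    (left_mem_segment ℝ p p') (right_mem_segment ℝ p p')
  simp only [div_self hpq, Complex.log_one, sub_zero] at this
  rw [linc]
  linear_combination this

lemma branch_exists {D : Set ℂ} {f q : ℂ} {R : ℝ}
    (hl : ∃ l : ℂ → ℂ, ContinuousOn l D ∧ ∀ z ∈ D, Complex.exp (l z) = z - f) (hq : ‖q - f‖ ≤ R) :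
    ∃ l : ℂ → ℂ, ContinuousOn l (D ∩ {z | R < ‖z - f‖}) ∧
      ∀ z ∈ D ∩ {z | R < ‖z - f‖}, Complex.exp (l z) = z - q := by
  obtain ⟨l, hc, he⟩ := hl
  have hn : ∀ z ∈ D ∩ {z | R < ‖z - f‖}, z - f ≠ 0 := by
    rintro z ⟨-, hz⟩ h
    rw [mem_ofPred_eq, h, norm_zero] at hz
    exact absurd (norm_nonneg (q - f)) (by linarith)
  have hsl : ∀ z ∈ D ∩ {z | R < ‖z - f‖}, (z - q) / (z - f) ∈ Complex.slitPlane := by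
    rintro z hz'
    have hz0 := hn z hz'
    have hz := hz'.2
    rw [mem_ofPred_eq] at hz
    rw [show (z - q) / (z - f) = 1 + -((q - f) / (z - f)) by field_simp; ring]
    apply Complex.mem_slitPlane_of_norm_lt_one
    rw [norm_neg, norm_div, div_lt_one (norm_pos_iff.2 hz0)]
    linarith
  refine ⟨fun z => l z + Complex.log ((z - q) / (z - f)), ?_, ?_⟩
  · refine (hc.mono inter_subset_left).add (ContinuousOn.clog ?_ hsl)
    exact ContinuousOn.div (by fun_prop) (by fun_prop) hn
  · intro z hz
    have h0 := Complex.slitPlane_ne_zero (hsl z hz)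
    rw [Complex.exp_add, he z hz.1, Complex.exp_log h0]
    have := hn z hz
    field_simp

noncomputable def gp (o : ℂ) (h : ℝ) (v : ℕ × ℕ) : ℂ := o + ⟨h * v.1, h * v.2⟩
noncomputable def gq (o : ℂ) (h : ℝ) (v : ℕ × ℕ) : ℂ := o + ⟨h * (v.1 + 1 / 2), h * (v.2 + 1 / 2)⟩

lemma circ_ne {o : ℂ} {h : ℝ} (hh : 0 < h) {i j a b : ℕ} (hne : (i, j) ≠ (a, b)) :
    linc (gq o h (i, j)) (gp o h (a, b)) (gp o h (a + 1, b))
    + linc (gq o h (i, j)) (gp o h (a + 1, b)) (gp o h (a + 1, b + 1))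
    - linc (gq o h (i, j)) (gp o h (a, b + 1)) (gp o h (a + 1, b + 1))
    - linc (gq o h (i, j)) (gp o h (a, b)) (gp o h (a, b + 1)) = 0 := by
  obtain ⟨c, h1, h2, h3, h4⟩ : ∃ c : ℂ, 0 < (c * (gp o h (a, b) - gq o h (i, j))).re ∧
      0 < (c * (gp o h (a + 1, b) - gq o h (i, j))).re ∧
      0 < (c * (gp o h (a + 1, b + 1) - gq o h (i, j))).re ∧
      0 < (c * (gp o h (a, b + 1) - gq o h (i, j))).re := by
    have : i + 1 ≤ a ∨ a + 1 ≤ i ∨ j + 1 ≤ b ∨ b + 1 ≤ j := by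
      by_contra hcon
      apply hne
      rw [Prod.mk.injEq]
      omega
    rcases this with k | k | k | k
    · have k' : (i:ℝ) + 1 ≤ a := by exact_mod_cast k
      have k2 := mul_le_mul_of_nonneg_left k' hh.le
      refine ⟨1, ?_, ?_, ?_, ?_⟩
      all_goals
        simp only [gp, gq, Complex.mul_re, Complex.sub_re, Complex.sub_im, Complex.add_re,
          Complex.add_im, Complex.one_re, Complex.one_im, Complex.neg_re, Complex.neg_im,
          Complex.I_re, Complex.I_im]
        push_cast
        nlinarith
    · have k' : (a:ℝ) + 1 ≤ i := by exact_mod_cast k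
      have k2 := mul_le_mul_of_nonneg_left k' hh.le
      refine ⟨-1, ?_, ?_, ?_, ?_⟩
      all_goals
        simp only [gp, gq, Complex.mul_re, Complex.sub_re, Complex.sub_im, Complex.add_re,
          Complex.add_im, Complex.one_re, Complex.one_im, Complex.neg_re, Complex.neg_im,
          Complex.I_re, Complex.I_im]
        push_cast
        nlinarith
    · have k' : (j:ℝ) + 1 ≤ b := by exact_mod_cast k
      have k2 := mul_le_mul_of_nonneg_left k' hh.le
      refine ⟨-Complex.I, ?_, ?_, ?_, ?_⟩
      all_goals
        simp only [gp, gq, Complex.mul_re, Complex.sub_re, Complex.sub_im, Complex.add_re,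
          Complex.add_im, Complex.one_re, Complex.one_im, Complex.neg_re, Complex.neg_im,
          Complex.I_re, Complex.I_im]
        push_cast
        nlinarith
    · have k' : (b:ℝ) + 1 ≤ j := by exact_mod_cast k
      have k2 := mul_le_mul_of_nonneg_left k' hh.le
      refine ⟨Complex.I, ?_, ?_, ?_, ?_⟩
      all_goals
        simp only [gp, gq, Complex.mul_re, Complex.sub_re, Complex.sub_im, Complex.add_re,
          Complex.add_im, Complex.one_re, Complex.one_im, Complex.neg_re, Complex.neg_im,
          Complex.I_re, Complex.I_im]
        push_cast
        nlinarith
  rw [linc_half c h1 h2, linc_half c h2 h3, linc_half c h4 h3, linc_half c h1 h4]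
  ring

lemma circ_self {o : ℂ} {h : ℝ} (hh : 0 < h) {i j : ℕ} :
    linc (gq o h (i, j)) (gp o h (i, j)) (gp o h (i + 1, j))
    + linc (gq o h (i, j)) (gp o h (i + 1, j)) (gp o h (i + 1, j + 1))
    - linc (gq o h (i, j)) (gp o h (i, j + 1)) (gp o h (i + 1, j + 1))
    - linc (gq o h (i, j)) (gp o h (i, j)) (gp o h (i, j + 1)) = 2 * Real.pi * Complex.I := by
  have e1 : gp o h (i, j) - gq o h (i, j) = (h / 2 : ℂ) * (-1 - Complex.I) := by
    apply Complex.ext <;> simp [gp, gq] <;> ring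
  have e2 : gp o h (i + 1, j) - gq o h (i, j) = (h / 2 : ℂ) * (1 - Complex.I) := by
    apply Complex.ext <;> simp [gp, gq] <;> ring
  have e3 : gp o h (i + 1, j + 1) - gq o h (i, j) = (h / 2 : ℂ) * (1 + Complex.I) := by
    apply Complex.ext <;> simp [gp, gq] <;> ring
  have e4 : gp o h (i, j + 1) - gq o h (i, j) = (h / 2 : ℂ) * (-1 + Complex.I) := by
    apply Complex.ext <;> simp [gp, gq] <;> ring
  have hh' : (h / 2 : ℂ) ≠ 0 := by
    have : (h : ℂ) ≠ 0 := by exact_mod_cast hh.ne'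
    simpa using this
  have n1 : (-1 - Complex.I) ≠ 0 := fun h => by simpa using congrArg Complex.re h
  have n2 : (1 - Complex.I) ≠ 0 := fun h => by simpa using congrArg Complex.re h
  have n4 : (-1 + Complex.I) ≠ 0 := fun h => by simpa using congrArg Complex.re h
  have I2 := Complex.I_mul_I
  have l1 : linc (gq o h (i, j)) (gp o h (i, j)) (gp o h (i + 1, j)) = Real.pi / 2 * Complex.I := by
    rw [linc, e1, e2, mul_div_mul_left _ _ hh', ← Complex.log_I]
    congr 1
    rw [div_eq_iff n1]
    linear_combination I2
  have l2 : linc (gq o h (i, j)) (gp o h (i + 1, j)) (gp o h (i + 1, j + 1)) = Real.pi / 2 * Complex.I := by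
    rw [linc, e3, e2, mul_div_mul_left _ _ hh', ← Complex.log_I]
    congr 1
    rw [div_eq_iff n2]
    linear_combination I2
  have l3 : linc (gq o h (i, j)) (gp o h (i, j + 1)) (gp o h (i + 1, j + 1)) = -(Real.pi / 2) * Complex.I := by
    rw [linc, e3, e4, mul_div_mul_left _ _ hh', ← Complex.log_neg_I]
    congr 1
    rw [div_eq_iff n4]
    linear_combination I2
  have l4 : linc (gq o h (i, j)) (gp o h (i, j)) (gp o h (i, j + 1)) = -(Real.pi / 2) * Complex.I := by
    rw [linc, e1, e4, mul_div_mul_left _ _ hh', ← Complex.log_neg_I]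
    congr 1
    rw [div_eq_iff n1]
    linear_combination -I2
  rw [l1, l2, l3, l4]
  ring

lemma exact_of_closed {H V : ℕ → ℕ → ℂ}
    (hc : ∀ i j, H i j + V (i + 1) j - H i (j + 1) - V i j = 0) :
    ∃ ψ : ℕ → ℕ → ℂ, (∀ i j, ψ (i + 1) j - ψ i j = H i j) ∧ (∀ i j, ψ i (j + 1) - ψ i j = V i j) := by
  refine ⟨fun i j => ∑ k ∈ Finset.range i, H k 0 + ∑ l ∈ Finset.range j, V i l, ?_, ?_⟩
  · intro i j
    simp only [Finset.sum_range_succ]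
    induction j with
    | zero => simp
    | succ j ih =>
      simp only [Finset.sum_range_succ]
      linear_combination ih + hc i j
  · intro i j
    simp only [Finset.sum_range_succ]
    ring

lemma box_const {F : ℕ → ℕ → ℂ} {i0 i1 j0 j1 : ℕ}
    (hH : ∀ i j, i0 ≤ i → i + 1 ≤ i1 → j0 ≤ j → j ≤ j1 → F (i + 1) j = F i j)
    (hV : ∀ i j, i0 ≤ i → i ≤ i1 → j0 ≤ j → j + 1 ≤ j1 → F i (j + 1) = F i j) {i j : ℕ}
    (h1 : i0 ≤ i) (h2 : i ≤ i1) (h3 : j0 ≤ j) (h4 : j ≤ j1) : F i j = F i0 j0 := by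
  have a : ∀ i, i0 ≤ i → i ≤ i1 → ∀ j, j0 ≤ j → j ≤ j1 → F i j = F i0 j := by
    intro i hi
    induction i, hi using Nat.le_induction with
    | base => intros; rfl
    | succ i hi ih =>
      intro h2 j h3 h4
      rw [hH i j hi h2 h3 h4, ih (by omega) j h3 h4]
  rw [a i h1 h2 j h3 h4]
  have h12 := h1.trans h2
  clear h1 h2 a i
  induction j, h3 using Nat.le_induction with
  | base => rfl
  | succ j hj ih => rw [hV i0 j le_rfl h12 hj h4, ih (by omega)]

open Metric Set
open MeasureTheory Filter Topology

def far (D : Set ℂ) (r : ℝ) (z : ℂ) : Prop := ∀ f, f ∉ D → r < ‖z - f‖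

def gadj (v w : ℕ × ℕ) : Prop :=
  w = (v.1 + 1, v.2) ∨ v = (w.1 + 1, w.2) ∨ w = (v.1, v.2 + 1) ∨ v = (w.1, w.2 + 1)

lemma gadj_symm {v w : ℕ × ℕ} (h : gadj v w) : gadj w v := by
  unfold gadj at *; tauto

def inbox (i0 i1 j0 j1 : ℕ) (v : ℕ × ℕ) : Prop := i0 ≤ v.1 ∧ v.1 ≤ i1 ∧ j0 ≤ v.2 ∧ v.2 ≤ j1

def chainRel (D : Set ℂ) (o : ℂ) (h r : ℝ) (B : ℕ × ℕ → Prop) (v w : ℕ × ℕ) : Prop :=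
  gadj v w ∧ B v ∧ B w ∧ far D r (gp o h v) ∧ far D r (gp o h w)

lemma gp_right (o : ℂ) (h : ℝ) (i j : ℕ) : gp o h (i + 1, j) - gp o h (i, j) = h := by
  apply Complex.ext <;> simp [gp] <;> ring

lemma gp_up (o : ℂ) (h : ℝ) (i j : ℕ) : gp o h (i, j + 1) - gp o h (i, j) = h * Complex.I := by
  apply Complex.ext <;> simp [gp] <;> ring

lemma gp_gadj {o : ℂ} {h : ℝ} (hh : 0 < h) {v w : ℕ × ℕ} (hvw : gadj v w) :
    ‖gp o h w - gp o h v‖ = h := by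
  have a : ∀ v : ℕ × ℕ, ‖gp o h (v.1 + 1, v.2) - gp o h v‖ = h := fun v => by
    rw [gp_right]; simp [hh.le]
  have b : ∀ v : ℕ × ℕ, ‖gp o h (v.1, v.2 + 1) - gp o h v‖ = h := fun v => by
    rw [gp_up]; simp [hh.le]
  rcases hvw with e | e | e | e
  · rw [e]; exact a v
  · rw [norm_sub_rev, e]; exact a w
  · rw [e]; exact b v
  · rw [norm_sub_rev, e]; exact b w

lemma gp_gq {o : ℂ} {h : ℝ} (hh : 0 < h) {i j a b : ℕ} (ha : a = i ∨ a = i + 1) (hb : b = j ∨ b = j + 1) :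
    ‖gq o h (i, j) - gp o h (a, b)‖ ≤ h := by
  have h2 : (h * h / 4 + h * h / 4) ≤ h ^ 2 := by nlinarith
  rw [Complex.norm_eq_sqrt_sq_add_sq, Real.sqrt_le_iff]
  refine ⟨hh.le, ?_⟩
  refine le_trans (le_of_eq ?_) h2
  rcases ha with rfl | rfl <;> rcases hb with rfl | rfl <;> simp [gp, gq] <;> ring

lemma seg_dist {p p' z : ℂ} (hz : z ∈ segment ℝ p p') : ‖z - p‖ ≤ ‖p' - p‖ := by
  obtain ⟨t, ht, rfl⟩ := (segment_eq_image' ℝ p p').subset hz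
  simp only [add_sub_cancel_left, norm_smul, Real.norm_of_nonneg ht.1]
  nlinarith [norm_nonneg (p' - p), ht.2]

open Classical in
lemma key {D : Set ℂ} {o : ℂ} {h : ℝ} (hh : 0 < h)
    (hlog : ∀ f, f ∉ D → ∃ l : ℂ → ℂ, ContinuousOn l D ∧ ∀ z ∈ D, Complex.exp (l z) = z - f)
    {i0 i1 j0 j1 : ℕ} {vx vy : ℕ × ℕ} {T : Set ℂ} (hT : IsPreconnected T) (hTD : T ⊆ D)
    (hxT : gp o h vx ∈ T) (hyT : gp o h vy ∈ T)
    (hbox : ∀ z ∈ T, o.re + h * i0 + 7 * h ≤ z.re ∧ z.re ≤ o.re + h * i1 - 7 * h ∧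
      o.im + h * j0 + 7 * h ≤ z.im ∧ z.im ≤ o.im + h * j1 - 7 * h)
    (hchain : Relation.ReflTransGen (chainRel D o h (5 * h) (fun _ => True)) vx vy) :
    Relation.ReflTransGen (chainRel D o h (2 * h) (inbox i0 i1 j0 j1)) vx vy := by
  set R := Relation.ReflTransGen (chainRel D o h (2 * h) (inbox i0 i1 j0 j1)) vx with hR
  set B := inbox i0 i1 j0 j1 with hB
  set P := gp o h with hP
  set Q := gq o h with hQ
  set u : ℕ × ℕ → ℂ := fun v => if R v then 1 else 0 with hu
  have hvB : ∀ v : ℕ × ℕ, P v ∈ T → B v := by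
    intro v hv
    obtain ⟨a1, a2, a3, a4⟩ := hbox _ hv
    simp only [hP, gp, Complex.add_re, Complex.add_im] at a1 a2 a3 a4
    refine ⟨?_, ?_, ?_, ?_⟩
    · have : (i0:ℝ) ≤ v.1 := le_of_mul_le_mul_left (by linarith) hh
      exact_mod_cast this
    · have : (v.1:ℝ) ≤ i1 := le_of_mul_le_mul_left (by linarith) hh
      exact_mod_cast this
    · have : (j0:ℝ) ≤ v.2 := le_of_mul_le_mul_left (by linarith) hh
      exact_mod_cast this
    · have : (v.2:ℝ) ≤ j1 := le_of_mul_le_mul_left (by linarith) hh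
      exact_mod_cast this
  have hueq : ∀ v w, gadj v w → B v → B w → far D (2 * h) (P v) → far D (2 * h) (P w) → u v = u w := by
    intro v w a1 a2 a3 a4 a5
    have : R v ↔ R w := ⟨fun hr => hr.tail ⟨a1, a2, a3, a4, a5⟩,
      fun hr => hr.tail ⟨gadj_symm a1, a3, a2, a5, a4⟩⟩
    simp only [hu, this]
  set H : ℕ → ℕ → ℂ := fun i j => if B (i, j) ∧ B (i + 1, j) then u (i + 1, j) - u (i, j) else 0 with hH
  set V : ℕ → ℕ → ℂ := fun i j => if B (i, j) ∧ B (i, j + 1) then u (i, j + 1) - u (i, j) else 0 with hV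
  have hH0 : ∀ i j, far D (2 * h) (P (i, j)) → far D (2 * h) (P (i + 1, j)) → H i j = 0 := by
    intro i j a1 a2
    simp only [hH]
    split_ifs with hc
    · rw [hueq _ _ (Or.inl rfl) hc.1 hc.2 a1 a2, sub_self]
    · rfl
  have hV0 : ∀ i j, far D (2 * h) (P (i, j)) → far D (2 * h) (P (i, j + 1)) → V i j = 0 := by
    intro i j a1 a2
    simp only [hV]
    split_ifs with hc
    · rw [hueq _ _ (Or.inr (Or.inr (Or.inl rfl))) hc.1 hc.2 a1 a2, sub_self]
    · rfl
  set circ : ℕ × ℕ → ℂ := fun s => H s.1 s.2 + V (s.1 + 1) s.2 - H s.1 (s.2 + 1) - V s.1 s.2 with hcirc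
  set S : Finset (ℕ × ℕ) := (Finset.range (i1 + 1) ×ˢ Finset.range (j1 + 1)).filter (fun s => circ s ≠ 0) with hS
  have hcS : ∀ s, circ s ≠ 0 → s ∈ S := by
    rintro ⟨i, j⟩ hs
    simp only [hS, Finset.mem_filter, Finset.mem_product, Finset.mem_range]
    refine ⟨?_, hs⟩
    by_contra hcon
    apply hs
    have b1 : ¬ B (i, j) := fun hb => by simp only [hB, inbox] at hb; omega
    have b2 : ¬ B (i + 1, j) := fun hb => by simp only [hB, inbox] at hb; omega
    have b3 : ¬ B (i, j + 1) := fun hb => by simp only [hB, inbox] at hb; omega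
    simp [hcirc, hH, hV, b1, b2, b3]
  have hf : ∀ s ∈ S, ∃ f, f ∉ D ∧ ‖Q s - f‖ ≤ 3 * h := by
    rintro ⟨i, j⟩ hs
    by_contra hcon
    push Not at hcon
    have hfar : ∀ a b, (a = i ∨ a = i + 1) → (b = j ∨ b = j + 1) → far D (2 * h) (P (a, b)) := by
      intro a b ha hb f hf
      have h1 := gp_gq (o := o) hh ha hb
      have h2 := hcon f hf
      have h3 : ‖Q (i, j) - f‖ ≤ ‖Q (i, j) - P (a, b)‖ + ‖P (a, b) - f‖ := norm_sub_le_norm_sub_add_norm_sub _ _ _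
      linarith
    apply (Finset.mem_filter.1 hs).2
    simp only [hcirc]
    rw [hH0 i j (hfar _ _ (by simp) (by simp)) (hfar _ _ (by simp) (by simp)),
      hH0 i (j + 1) (hfar _ _ (by simp) (by simp)) (hfar _ _ (by simp) (by simp)),
      hV0 i j (hfar _ _ (by simp) (by simp)) (hfar _ _ (by simp) (by simp)),
      hV0 (i + 1) j (hfar _ _ (by simp) (by simp)) (hfar _ _ (by simp) (by simp))]
    simp
  have hout : ∀ s ∈ S, s.1 + 1 ≤ i0 ∨ i1 ≤ s.1 ∨ s.2 + 1 ≤ j0 ∨ j1 ≤ s.2 := by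
    rintro ⟨i, j⟩ hs
    by_contra hcon
    apply (Finset.mem_filter.1 hs).2
    simp only at hcon
    have b1 : B (i, j) := by simp only [hB, inbox]; omega
    have b2 : B (i + 1, j) := by simp only [hB, inbox]; omega
    have b3 : B (i, j + 1) := by simp only [hB, inbox]; omega
    have b4 : B (i + 1, j + 1) := by simp only [hB, inbox]; omega
    simp [hcirc, hH, hV, b1, b2, b3, b4]
  have hc : ∀ s ∈ S, ∃ c : ℂ, (∀ z : ℂ, o.re + h * i0 ≤ z.re → z.re ≤ o.re + h * i1 →
      o.im + h * j0 ≤ z.im → z.im ≤ o.im + h * j1 → 0 < (c * (z - Q s)).re) ∧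
      ∀ z ∈ T, 7 * h < ‖z - Q s‖ := by
    rintro ⟨i, j⟩ hs
    rcases hout _ hs with k | k | k | k
    · have k' : (i:ℝ) + 1 ≤ i0 := by exact_mod_cast k
      have k2 := mul_le_mul_of_nonneg_left k' hh.le
      refine ⟨1, fun z z1 z2 z3 z4 => ?_, fun z hz => ?_⟩
      · simp [hQ, gq]; linarith
      · obtain ⟨a1, a2, a3, a4⟩ := hbox z hz
        refine lt_of_lt_of_le ?_ (Complex.abs_re_le_norm _)
        refine lt_of_lt_of_le ?_ (le_abs_self _)
        simp [hQ, gq]; linarith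
    · have k' : (i1:ℝ) ≤ i := by exact_mod_cast k
      have k2 := mul_le_mul_of_nonneg_left k' hh.le
      refine ⟨-1, fun z z1 z2 z3 z4 => ?_, fun z hz => ?_⟩
      · simp [hQ, gq]; linarith
      · obtain ⟨a1, a2, a3, a4⟩ := hbox z hz
        refine lt_of_lt_of_le ?_ (Complex.abs_re_le_norm _)
        refine lt_of_lt_of_le ?_ (neg_le_abs _)
        simp [hQ, gq]; linarith
    · have k' : (j:ℝ) + 1 ≤ j0 := by exact_mod_cast k
      have k2 := mul_le_mul_of_nonneg_left k' hh.le
      refine ⟨-Complex.I, fun z z1 z2 z3 z4 => ?_, fun z hz => ?_⟩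
      · simp [hQ, gq]; linarith
      · obtain ⟨a1, a2, a3, a4⟩ := hbox z hz
        refine lt_of_lt_of_le ?_ (Complex.abs_im_le_norm _)
        refine lt_of_lt_of_le ?_ (le_abs_self _)
        simp [hQ, gq]; linarith
    · have k' : (j1:ℝ) ≤ j := by exact_mod_cast k
      have k2 := mul_le_mul_of_nonneg_left k' hh.le
      refine ⟨Complex.I, fun z z1 z2 z3 z4 => ?_, fun z hz => ?_⟩
      · simp [hQ, gq]; linarith
      · obtain ⟨a1, a2, a3, a4⟩ := hbox z hz
        refine lt_of_lt_of_le ?_ (Complex.abs_im_le_norm _)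
        refine lt_of_lt_of_le ?_ (neg_le_abs _)
        simp [hQ, gq]; linarith
  choose! f hfD hfQ using hf
  have hl : ∀ s ∈ S, ∃ l : ℂ → ℂ, ContinuousOn l (D ∩ {z | 3 * h < ‖z - f s‖}) ∧
      ∀ z ∈ D ∩ {z | 3 * h < ‖z - f s‖}, Complex.exp (l z) = z - Q s := fun s hs =>
    branch_exists (hlog (f s) (hfD s hs)) (hfQ s hs)
  choose! l hlc hle using hl
  choose! c hc1 hc2 using hc
  set κ : ℕ × ℕ → ℂ := fun s => circ s / (2 * Real.pi * Complex.I) with hκ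
  have h2pi : (2 * Real.pi * Complex.I : ℂ) ≠ 0 := by simp [Real.pi_ne_zero]
  obtain ⟨ψ, hψH, hψV⟩ := exact_of_closed
    (H := fun i j => H i j - ∑ s ∈ S, κ s * linc (Q s) (P (i, j)) (P (i + 1, j)))
    (V := fun i j => V i j - ∑ s ∈ S, κ s * linc (Q s) (P (i, j)) (P (i, j + 1))) (by
      intro i j
      have e : ∀ s ∈ S, κ s * (linc (Q s) (P (i, j)) (P (i + 1, j)) +
          linc (Q s) (P (i + 1, j)) (P (i + 1, j + 1)) - linc (Q s) (P (i, j + 1)) (P (i + 1, j + 1)) -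
          linc (Q s) (P (i, j)) (P (i, j + 1))) = if s = (i, j) then circ (i, j) else 0 := by
        rintro ⟨a, b⟩ -
        split_ifs with hs
        · rw [hs, circ_self hh, hκ]
          exact div_mul_cancel₀ _ h2pi
        · rw [circ_ne hh hs, mul_zero]
      have e2 := Finset.sum_congr rfl e
      rw [Finset.sum_ite_eq'] at e2
      have e3 : (if (i, j) ∈ S then circ (i, j) else 0) = circ (i, j) := by
        split_ifs with hs
        · rfl
        · by_contra hne
          exact hs (hcS _ (Ne.symm hne))
      rw [e3] at e2
      simp only [mul_add, mul_sub, Finset.sum_add_distrib, Finset.sum_sub_distrib] at e2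
      simp only [hcirc] at e2
      linear_combination -e2)
  -- inside the box
  set F : ℕ → ℕ → ℂ := fun i j => ψ i j - u (i, j) + ∑ s ∈ S, κ s * Complex.log (c s * (P (i, j) - Q s)) with hF
  have hpos : ∀ s ∈ S, ∀ v, B v → 0 < (c s * (P v - Q s)).re := by
    intro s hs v ⟨b1, b2, b3, b4⟩
    apply hc1 s hs
    all_goals simp only [hP, gp, Complex.add_re, Complex.add_im]
    all_goals
      gcongr
  have hFc : ∀ v, B v → F v.1 v.2 = F i0 j0 := by
    intro v ⟨b1, b2, b3, b4⟩
    refine box_const (F := F) ?_ ?_ b1 b2 b3 b4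
    · intro i j k1 k2 k3 k4
      have B1 : B (i, j) := ⟨by simpa using k1, by simp; omega, by simpa using k3, by simpa using k4⟩
      have B2 : B (i + 1, j) := ⟨by simp; omega, by simpa using k2, by simpa using k3, by simpa using k4⟩
      have e : ∑ s ∈ S, κ s * linc (Q s) (P (i, j)) (P (i + 1, j)) =
          ∑ s ∈ S, κ s * Complex.log (c s * (P (i + 1, j) - Q s)) -
          ∑ s ∈ S, κ s * Complex.log (c s * (P (i, j) - Q s)) := by
        rw [← Finset.sum_sub_distrib]
        refine Finset.sum_congr rfl fun s hs => ?_
        rw [linc_half (c s) (hpos s hs _ B1) (hpos s hs _ B2), mul_sub]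
      have e2 := hψH i j
      have e3 : H i j = u (i + 1, j) - u (i, j) := by simp only [hH, B1, B2, and_self, if_true]
      simp only [hF]
      rw [e3] at e2
      linear_combination e2 - e
    · intro i j k1 k2 k3 k4
      have B1 : B (i, j) := ⟨by simpa using k1, by simpa using k2, by simpa using k3, by simp; omega⟩
      have B2 : B (i, j + 1) := ⟨by simpa using k1, by simpa using k2, by simp; omega, by simpa using k4⟩
      have e : ∑ s ∈ S, κ s * linc (Q s) (P (i, j)) (P (i, j + 1)) =
          ∑ s ∈ S, κ s * Complex.log (c s * (P (i, j + 1) - Q s)) -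
          ∑ s ∈ S, κ s * Complex.log (c s * (P (i, j) - Q s)) := by
        rw [← Finset.sum_sub_distrib]
        refine Finset.sum_congr rfl fun s hs => ?_
        rw [linc_half (c s) (hpos s hs _ B1) (hpos s hs _ B2), mul_sub]
      have e2 := hψV i j
      have e3 : V i j = u (i, j + 1) - u (i, j) := by simp only [hV, B1, B2, and_self, if_true]
      simp only [hF]
      rw [e3] at e2
      linear_combination e2 - e
  -- along the chain
  set G : ℕ × ℕ → ℂ := fun v => ψ v.1 v.2 + ∑ s ∈ S, κ s * l s (P v) with hG
  have hlin : ∀ v w, gadj v w → far D (5 * h) (P v) → ∀ s ∈ S,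
      linc (Q s) (P v) (P w) = l s (P w) - l s (P v) := by
    intro v w hvw hv s hs
    have hd := gp_gadj (o := o) hh hvw
    have hsub : segment ℝ (P v) (P w) ⊆ D ∩ {z | 3 * h < ‖z - f s‖} := by
      intro z hz
      have h1 := seg_dist hz
      have h2 : ‖z - P v‖ ≤ h := h1.trans hd.le
      constructor
      · by_contra hzD
        have := hv z hzD
        rw [norm_sub_rev] at this
        linarith
      · have h3 := hv (f s) (hfD s hs)
        have h4 := norm_sub_le_norm_sub_add_norm_sub (P v) z (f s)
        rw [norm_sub_rev (P v) z] at h4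
        show 3 * h < ‖z - f s‖
        linarith
    refine linc_branch ((hlc s hs).mono hsub) (fun z hz => hle s hs z (hsub hz)) ?_
    have h3 := hv (f s) (hfD s hs)
    have h4 := norm_sub_le_norm_sub_add_norm_sub (P v) (Q s) (f s)
    have h5 := hfQ s hs
    have hd' : ‖P w - P v‖ = h := hd
    linarith
  have hfarmono : ∀ v, far D (5 * h) (P v) → far D (2 * h) (P v) := fun v hv f hf => by
    have := hv f hf; linarith
  have hGH : ∀ i j, far D (5 * h) (P (i, j)) → far D (5 * h) (P (i + 1, j)) → G (i + 1, j) = G (i, j) := by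
    intro i j a1 a2
    have e := hψH i j
    simp only [hH0 i j (hfarmono _ a1) (hfarmono _ a2)] at e
    have e2 : ∑ s ∈ S, κ s * linc (Q s) (P (i, j)) (P (i + 1, j)) =
        ∑ s ∈ S, κ s * l s (P (i + 1, j)) - ∑ s ∈ S, κ s * l s (P (i, j)) := by
      rw [← Finset.sum_sub_distrib]
      refine Finset.sum_congr rfl fun s hs => ?_
      rw [hlin _ _ (Or.inl rfl) a1 s hs, mul_sub]
    simp only [hG]
    linear_combination e - e2
  have hGV : ∀ i j, far D (5 * h) (P (i, j)) → far D (5 * h) (P (i, j + 1)) → G (i, j + 1) = G (i, j) := by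
    intro i j a1 a2
    have e := hψV i j
    simp only [hV0 i j (hfarmono _ a1) (hfarmono _ a2)] at e
    have e2 : ∑ s ∈ S, κ s * linc (Q s) (P (i, j)) (P (i, j + 1)) =
        ∑ s ∈ S, κ s * l s (P (i, j + 1)) - ∑ s ∈ S, κ s * l s (P (i, j)) := by
      rw [← Finset.sum_sub_distrib]
      refine Finset.sum_congr rfl fun s hs => ?_
      rw [hlin _ _ (Or.inr (Or.inr (Or.inl rfl))) a1 s hs, mul_sub]
    simp only [hG]
    linear_combination e - e2
  have hGc : G vy = G vx := by
    have hstep : ∀ v w, chainRel D o h (5 * h) (fun _ => True) v w → G w = G v := by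
      rintro ⟨i, j⟩ ⟨i', j'⟩ ⟨ha, -, -, a1, a2⟩
      rcases ha with e | e | e | e
      · simp only at e
        rw [e] at a2 ⊢
        exact hGH i j a1 a2
      · simp only at e
        rw [e] at a1 ⊢
        exact (hGH i' j' a2 a1).symm
      · simp only at e
        rw [e] at a2 ⊢
        exact hGV i j a1 a2
      · simp only at e
        rw [e] at a1 ⊢
        exact (hGV i' j' a2 a1).symm
    clear hyT
    induction hchain with
    | refl => rfl
    | tail _ hs ih => exact (hstep _ _ hs).trans ih
  -- via T
  have hTc : ∀ s ∈ S, l s (P vy) - Complex.log (c s * (P vy - Q s)) =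
      l s (P vx) - Complex.log (c s * (P vx - Q s)) := by
    intro s hs
    have hposT : ∀ z ∈ T, 0 < (c s * (z - Q s)).re := by
      intro z hz
      obtain ⟨a1, a2, a3, a4⟩ := hbox z hz
      exact hc1 s hs z (by linarith) (by linarith) (by linarith) (by linarith)
    have hsub : T ⊆ D ∩ {z | 3 * h < ‖z - f s‖} := by
      intro z hz
      refine ⟨hTD hz, ?_⟩
      have h1 := hc2 s hs z hz
      have h2 := hfQ s hs
      have h3 := norm_sub_le_norm_sub_add_norm_sub z (f s) (Q s)
      rw [norm_sub_rev (f s)] at h3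
      show 3 * h < ‖z - f s‖
      linarith
    refine exp_const (g := fun z => l s z - Complex.log (c s * (z - Q s))) (k := (c s)⁻¹) hT ?_ ?_ hyT hxT
    · refine ((hlc s hs).mono hsub).sub (ContinuousOn.clog (by fun_prop) fun z hz => ?_)
      exact Or.inl (hposT z hz)
    · intro z hz
      have hne : c s * (z - Q s) ≠ 0 := fun h0 => by
        have := hposT z hz
        simp [h0] at this
      rw [Complex.exp_sub, hle s hs z (hsub hz), Complex.exp_log hne]
      have n1 := left_ne_zero_of_mul hne
      have n2 := right_ne_zero_of_mul hne
      field_simp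
  have hTs : ∑ s ∈ S, κ s * l s (P vy) - ∑ s ∈ S, κ s * Complex.log (c s * (P vy - Q s)) =
      ∑ s ∈ S, κ s * l s (P vx) - ∑ s ∈ S, κ s * Complex.log (c s * (P vx - Q s)) := by
    rw [← Finset.sum_sub_distrib, ← Finset.sum_sub_distrib]
    refine Finset.sum_congr rfl fun s hs => ?_
    rw [← mul_sub, hTc s hs, mul_sub]
  have hF1 := (hFc _ (hvB vy hyT)).trans (hFc _ (hvB vx hxT)).symm
  simp only [hF, Prod.mk.eta] at hF1
  simp only [hG] at hGc
  have hfin : u vy = u vx := by linear_combination hGc - hTs - hF1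
  have hux : u vx = 1 := by simp only [hu]; exact if_pos Relation.ReflTransGen.refl
  rw [hux] at hfin
  by_contra hcon
  simp [hu, hcon] at hfin

open Metric Set
open MeasureTheory Filter Topology

lemma rt_split {α : Type*} {r : α → α → Prop} {a b : α} (h : Relation.ReflTransGen r a b) :
    a = b ∨ ∃ a', r a a' ∧ Relation.ReflTransGen (fun v w => r v w ∧ v ≠ a ∧ w ≠ a) a' b := by
  induction h with
  | refl => exact Or.inl rfl
  | @tail b c _ hbc ih =>
    by_cases hc : c = a
    · exact Or.inl hc.symm
    · right
      by_cases hb : b = a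
      · exact ⟨c, hb ▸ hbc, Relation.ReflTransGen.refl⟩
      · rcases ih with ih | ⟨a', h1, h2⟩
        · exact absurd ih.symm hb
        · exact ⟨a', h1, h2.tail ⟨hbc, hb, hc⟩⟩

lemma rt_bound {α : Type*} [DecidableEq α] {d : α → α → ℝ} {M : ℝ} (hM : 0 ≤ M) {X : Set α}
    (hd0 : ∀ a ∈ X, d a a ≤ 0)
    (htri : ∀ a ∈ X, ∀ b ∈ X, ∀ c ∈ X, d a c ≤ d a b + d b c) (n : ℕ) :
    ∀ (A : Finset α), A.card = n → ∀ (r : α → α → Prop) (a b : α), a ∈ X → b ∈ X →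
    (∀ v w, r v w → d v w ≤ M ∧ w ∈ A ∧ v ∈ A ∧ w ∈ X) → Relation.ReflTransGen r a b → d a b ≤ n * M := by
  induction n with
  | zero =>
    intro A hA r a b ha hb hr h
    rcases rt_split h with rfl | ⟨a', h1, h2⟩
    · simpa using hd0 a ha
    · have := (hr _ _ h1).2.1
      rw [Finset.card_eq_zero] at hA
      simp [hA] at this
  | succ n ih =>
    intro A hA r a b ha hb hr h
    rcases rt_split h with rfl | ⟨a', h1, h2⟩
    · have := hd0 a ha
      have : 0 ≤ ((n + 1 : ℕ) : ℝ) * M := by positivity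
      linarith
    · obtain ⟨k1, k2, k3, k4⟩ := hr _ _ h1
      have := ih (A.erase a) (by rw [Finset.card_erase_of_mem k3, hA]; rfl) _ a' b k4 hb (by
        rintro v w ⟨hvw, hv, hw⟩
        obtain ⟨l1, l2, l3, l4⟩ := hr _ _ hvw
        exact ⟨l1, Finset.mem_erase.2 ⟨hw, l2⟩, Finset.mem_erase.2 ⟨hv, l3⟩, l4⟩) h2
      have h3 := htri a ha a' k4 b hb
      push_cast
      linarith

lemma far_mem {D : Set ℂ} {r : ℝ} (hr : 0 ≤ r) {z : ℂ} (h : far D r z) : z ∈ D := by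
  by_contra hz
  have := h z hz
  simp at this
  linarith

lemma far_of_bdist {D : Set ℂ} (ho : IsOpen D) {r : ℝ} {z : ℂ} (hz : z ∈ D) (h : r < bdist D z) :
    far D r z := by
  intro f hf
  by_contra hcon
  push Not at hcon
  apply hf
  apply ball_bdist ho hz
  rw [mem_ball, dist_comm, dist_eq_norm]
  linarith

lemma bdist_of_far {D : Set ℂ} (ho : IsOpen D) (hb : Bornology.IsBounded D) {r : ℝ} {z : ℂ} (hz : z ∈ D)
    (h : far D r z) : r ≤ bdist D z := by
  rw [bdist, le_infDist (frontier_ne hb ⟨z, hz⟩)]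
  intro f hf
  rw [ho.frontier_eq] at hf
  rw [dist_eq_norm]
  exact (h f hf.2).le

lemma far_near {D : Set ℂ} {r s : ℝ} {z w : ℂ} (h : far D r z) (hd : ‖z - w‖ ≤ r - s) : far D s w := by
  intro f hf
  have := h f hf
  have := norm_sub_le_norm_sub_add_norm_sub z w f
  linarith

noncomputable def fl (o : ℂ) (h : ℝ) (z : ℂ) : ℕ × ℕ :=
  (⌊(z.re - o.re) / h⌋₊, ⌊(z.im - o.im) / h⌋₊)

lemma fl_aux {a o h : ℝ} (hh : 0 < h) (ha : o ≤ a) :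
    o + h * (⌊(a - o) / h⌋₊ : ℕ) ≤ a ∧ a ≤ o + h * (⌊(a - o) / h⌋₊ : ℕ) + h := by
  have h1 := Nat.floor_le (a := (a - o) / h) (div_nonneg (by linarith) hh.le)
  have h2 := (Nat.lt_floor_add_one ((a - o) / h)).le
  rw [le_div_iff₀ hh] at h1
  rw [div_le_iff₀ hh] at h2
  constructor <;> linarith

lemma norm_le_re_im {z : ℂ} {a b : ℝ} (h1 : |z.re| ≤ a) (h2 : |z.im| ≤ b) : ‖z‖ ≤ a + b :=
  (Complex.norm_le_abs_re_add_abs_im z).trans (by linarith)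

lemma fl_dist {o : ℂ} {h : ℝ} (hh : 0 < h) {z : ℂ} (h1 : o.re ≤ z.re) (h2 : o.im ≤ z.im) :
    ‖z - gp o h (fl o h z)‖ ≤ 2 * h := by
  have a := fl_aux hh h1
  have b := fl_aux hh h2
  have : ‖z - gp o h (fl o h z)‖ ≤ h + h := by
    apply norm_le_re_im <;> rw [abs_le] <;> simp only [gp, fl, Complex.sub_re, Complex.add_re, Complex.sub_im, Complex.add_im] <;> constructor <;> linarith
  linarith

lemma chainRel_symm {D : Set ℂ} {o : ℂ} {h r : ℝ} {B : ℕ × ℕ → Prop} {v w : ℕ × ℕ}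
    (k : chainRel D o h r B v w) : chainRel D o h r B w v :=
  ⟨gadj_symm k.1, k.2.2.1, k.2.1, k.2.2.2.2, k.2.2.2.1⟩

lemma rtg_symm {D : Set ℂ} {o : ℂ} {h r : ℝ} {B : ℕ × ℕ → Prop} {v w : ℕ × ℕ}
    (k : Relation.ReflTransGen (chainRel D o h r B) v w) :
    Relation.ReflTransGen (chainRel D o h r B) w v := by
  induction k with
  | refl => exact Relation.ReflTransGen.refl
  | tail _ hs ih => exact Relation.ReflTransGen.head (chainRel_symm hs) ih

lemma floor_near {a a' o h : ℝ} (hh : 0 < h) (ha : o ≤ a) (ha' : o ≤ a') (hd : |a' - a| < h) :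
    ⌊(a' - o) / h⌋₊ = ⌊(a - o) / h⌋₊ ∨ ⌊(a' - o) / h⌋₊ = ⌊(a - o) / h⌋₊ + 1 ∨
    ⌊(a - o) / h⌋₊ = ⌊(a' - o) / h⌋₊ + 1 := by
  have e : ∀ a a' : ℝ, a' < a + h → o ≤ a → ⌊(a' - o) / h⌋₊ ≤ ⌊(a - o) / h⌋₊ + 1 := by
    intro a a' h1 h2
    rw [← Nat.floor_add_one (div_nonneg (by linarith) hh.le)]
    apply Nat.floor_le_floor
    rw [div_add_one hh.ne']
    gcongr
    linarith
  have h1 := abs_lt.1 hd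
  have := e a a' (by linarith) ha
  have := e a' a (by linarith) ha'
  omega

lemma chain_of_preconn {D : Set ℂ} {o : ℂ} {h : ℝ} (hh : 0 < h) {S : Set ℂ} (hS : IsPreconnected S)
    (hfar : ∀ z ∈ S, far D (9 * h) z) (ho : ∀ z ∈ S, o.re ≤ z.re ∧ o.im ≤ z.im) {x y : ℂ}
    (hx : x ∈ S) (hy : y ∈ S) :
    Relation.ReflTransGen (chainRel D o h (5 * h) (fun _ => True)) (fl o h x) (fl o h y) := by
  refine hS.induction₂ (fun x y => Relation.ReflTransGen (chainRel D o h (5 * h) (fun _ => True))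
    (fl o h x) (fl o h y)) ?_ (fun x y z _ _ _ h1 h2 => h1.trans h2)
    (fun x y _ _ h1 => rtg_symm h1) hx hy
  intro z hz
  filter_upwards [mem_nhdsWithin_of_mem_nhds (ball_mem_nhds z hh), self_mem_nhdsWithin] with w hw hwS
  rw [mem_ball, dist_eq_norm] at hw
  obtain ⟨z1, z2⟩ := ho z hz
  obtain ⟨w1, w2⟩ := ho w hwS
  have d1 : |w.re - z.re| < h := lt_of_le_of_lt (Complex.abs_re_le_norm (w - z)) hw
  have d2 : |w.im - z.im| < h := lt_of_le_of_lt (Complex.abs_im_le_norm (w - z)) hw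
  have fz : far D (5 * h) (gp o h (fl o h z)) :=
    far_near (hfar z hz) ((fl_dist hh z1 z2).trans (by linarith))
  have fw : far D (5 * h) (gp o h (fl o h w)) :=
    far_near (hfar w hwS) ((fl_dist hh w1 w2).trans (by linarith))
  have fm : far D (5 * h) (gp o h ((fl o h w).1, (fl o h z).2)) := by
    refine far_near (hfar z hz) ?_
    have a := fl_aux hh w1
    have b := fl_aux hh z2
    have h1 := abs_lt.1 d1
    have : ‖z - gp o h ((fl o h w).1, (fl o h z).2)‖ ≤ 2 * h + h := by
      apply norm_le_re_im <;> rw [abs_le] <;> simp only [gp, fl, Complex.sub_re, Complex.add_re, Complex.sub_im, Complex.add_im] <;> constructor <;> linarith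
    linarith
  have s1 : Relation.ReflTransGen (chainRel D o h (5 * h) (fun _ => True)) (fl o h z)
      ((fl o h w).1, (fl o h z).2) := by
    rcases floor_near hh z1 w1 d1 with e | e | e
    · have : ((fl o h w).1, (fl o h z).2) = fl o h z := by
        simp only [fl]; rw [e]
      rw [this]
    · refine Relation.ReflTransGen.single ⟨Or.inl ?_, trivial, trivial, fz, fm⟩
      simp only [fl]; rw [e]
    · refine Relation.ReflTransGen.single ⟨Or.inr (Or.inl ?_), trivial, trivial, fz, fm⟩
      simp only [fl]; rw [e]
  refine s1.trans ?_
  rcases floor_near hh z2 w2 d2 with e | e | e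
  · have : ((fl o h w).1, (fl o h z).2) = fl o h w := by
      simp only [fl]; rw [e]
    rw [this]
  · refine Relation.ReflTransGen.single ⟨Or.inr (Or.inr (Or.inl ?_)), trivial, trivial, fm, fw⟩
    simp only [fl]; rw [e]
  · refine Relation.ReflTransGen.single ⟨Or.inr (Or.inr (Or.inr ?_)), trivial, trivial, fm, fw⟩
    simp only [fl]; rw [e]

lemma mDist_seg {D : Set ℂ} (ho : IsOpen D) (hb : Bornology.IsBounded D) {x y : ℂ} {r s : ℝ}
    (hx : x ∈ D) (hr : r + s ≤ bdist D x) (h0 : 0 < r) (hxy : ‖y - x‖ ≤ s) :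
    mDist D x y ≤ 2 / r * ‖y - x‖ ∧ segment ℝ x y ⊆ D := by
  have hsub : segment ℝ x y ⊆ D := by
    intro z hz
    apply ball_bdist ho hx
    rw [mem_ball, dist_eq_norm]
    have := seg_dist hz
    linarith
  refine ⟨pd_seg (mDensity_nonneg ho hb) (mDensity_cont ho hb) hsub fun z hz => ?_, hsub⟩
  refine (mDensity_le ho hb (hsub hz)).trans ?_
  have h1 := seg_dist hz
  have h2 := bdist_lip D x z
  rw [norm_sub_rev] at h2
  exact div_le_div_of_nonneg_left (by norm_num) h0 (by linarith)

lemma mDist_chain {D : Set ℂ} (ho : IsOpen D) (hb : Bornology.IsBounded D) (hc : IsConnected D)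
    {o : ℂ} {h : ℝ} (hh : 0 < h) {i0 i1 j0 j1 : ℕ} {v w : ℕ × ℕ} (hv : gp o h v ∈ D) (hw : gp o h w ∈ D)
    (hch : Relation.ReflTransGen (chainRel D o h (2 * h) (inbox i0 i1 j0 j1)) v w) :
    mDist D (gp o h v) (gp o h w) ≤ ((i1 + 1 - i0) * (j1 + 1 - j0) : ℕ) * 2 := by
  refine rt_bound (d := fun v w => mDist D (gp o h v) (gp o h w)) (M := 2) (by norm_num)
    (X := {v | gp o h v ∈ D}) ?_ ?_ _ (Finset.Icc i0 i1 ×ˢ Finset.Icc j0 j1) (by simp) _ v w hv hw ?_ hch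
  · intro a ha
    have := (mDist_seg ho hb (y := gp o h a) (r := bdist D (gp o h a)) (s := 0) ha (by simp)
      (bdist_pos ho hb ha) (by simp)).1
    simpa using this
  · intro a ha b hb' c hc'
    exact pd_triangle (mDensity_nonneg ho hb) (mDensity_cont ho hb) (rect_exists ho hb hc) ha hb' hc'
  · rintro a b ⟨k1, ⟨k2, k3, k4, k5⟩, ⟨l2, l3, l4, l5⟩, k6, k7⟩
    have ha := far_mem (by linarith) k6
    have hd := gp_gadj (o := o) hh k1
    have := (mDist_seg ho hb (y := gp o h b) (r := h) (s := h) ha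
      (by have := bdist_of_far ho hb ha k6; linarith) hh hd.le).1
    rw [hd, div_mul_cancel₀ _ hh.ne'] at this
    refine ⟨this, ?_, ?_, far_mem (by linarith) k7⟩
    · simp [*]
    · simp [*]

open Metric Set
open MeasureTheory Filter Topology

lemma john_carrot {D : Set ℂ} (ho : IsOpen D) (hb : Bornology.IsBounded D) (hJ : IsJohnDisk D) {z0 : ℂ}
    (hz0 : z0 ∈ D) : ∃ b : ℝ, 1 ≤ b ∧ ∀ x ∈ D, ∃ γ, IsRectPathIn D x z0 γ ∧
      ∀ t ∈ Icc (0:ℝ) 1, len γ 0 t ≤ b * bdist D (γ t) := by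
  obtain ⟨c, hc, H⟩ := hJ
  have r0 := bdist_pos ho hb hz0
  have hd : ∀ z ∈ D, bdist D z ≤ Metric.diam D := fun z hz => by
    have := two_bdist_le ho hb hz
    have := bdist_pos ho hb hz
    linarith
  have hdp := r0.trans_le (hd _ hz0)
  refine ⟨4 * c ^ 2 * Metric.diam D / bdist D z0 + c, ?_, fun x hx => ?_⟩
  · have : 0 ≤ 4 * c ^ 2 * Metric.diam D / bdist D z0 := by positivity
    linarith
  obtain ⟨γ, hγ, hm⟩ := H x hx z0 hz0
  refine ⟨γ, hγ, ?_⟩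
  obtain ⟨⟨K, hK⟩, g0, g1, gD⟩ := hγ
  have hor : ∀ t ∈ Icc (0:ℝ) 1, len γ 0 t ≤ c * bdist D (γ t) ∨ len γ t 1 ≤ c * bdist D (γ t) := by
    intro t ht
    have hp := bdist_pos ho hb (gD t ht)
    have hcp : 0 ≤ c * bdist D (γ t) := by positivity
    rcases min_le_iff.1 (hm t ht) with h | h
    · left
      exact (ENNReal.ofReal_le_ofReal_iff hcp).1 ((len_le_evar hK ht.1).trans h)
    · right
      exact (ENNReal.ofReal_le_ofReal_iff hcp).1 ((len_le_evar hK ht.2).trans h)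
  have hcont : ContinuousOn (fun r => len γ 0 r) (Icc 0 1) := (len_lip hK 0).continuous.continuousOn
  have hl0 := len_nonneg (γ := γ) (zero_le_one (α := ℝ))
  have hl : len γ 0 1 ≤ 2 * c * Metric.diam D := by
    obtain ⟨t, ht, et⟩ := intermediate_value_Icc (zero_le_one (α := ℝ)) hcont
      (show len γ 0 1 / 2 ∈ Icc (len γ 0 0) (len γ 0 1) by rw [len_self]; constructor <;> linarith)
    simp only at et
    have := len_add hK 0 t 1
    have h2 := hd _ (gD t ht)
    have h3 : c * bdist D (γ t) ≤ c * Metric.diam D := by gcongr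
    rcases hor t ht with h | h <;> linarith
  intro t ht
  have hp := bdist_pos ho hb (gD t ht)
  rcases hor t ht with h | h
  · have : 0 ≤ 4 * c ^ 2 * Metric.diam D / bdist D z0 * bdist D (γ t) := by positivity
    linarith
  · have h1 := bdist_lip D z0 (γ t)
    have h2 := dist_le_len hK ht.2
    rw [g1] at h2
    have h3 : bdist D z0 ≤ 2 * c * bdist D (γ t) := by nlinarith
    have h4 := len_add hK 0 t 1
    have h5 := len_nonneg (γ := γ) ht.2
    have h6 : 2 * c * Metric.diam D ≤ 4 * c ^ 2 * Metric.diam D / bdist D z0 * bdist D (γ t) := by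
      rw [div_mul_eq_mul_div, le_div_iff₀ r0]
      have : 2 * c * Metric.diam D * bdist D z0 ≤ 2 * c * Metric.diam D * (2 * c * bdist D (γ t)) := by
        gcongr
      linarith
    have : 0 ≤ c * bdist D (γ t) := by positivity
    linarith

lemma carrot_m {D : Set ℂ} (ho : IsOpen D) (hb : Bornology.IsBounded D) {b : ℝ} (hb1 : 1 ≤ b) {x z0 : ℂ}
    {γ : ℝ → ℂ} (hγ : IsRectPathIn D x z0 γ) (hc : ∀ t ∈ Icc (0:ℝ) 1, len γ 0 t ≤ b * bdist D (γ t))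
    {t : ℝ} (ht : t ∈ Icc (0:ℝ) 1) :
    mDist D x (γ t) ≤ 2 * (1 + 2 * b) * Real.log ((bdist D x + len γ 0 t) / bdist D x) := by
  obtain ⟨⟨K, hK⟩, g0, g1, gD⟩ := hγ
  have gD' : ∀ r ∈ Icc 0 t, γ r ∈ D := fun r hr => gD r ⟨hr.1, hr.2.trans ht.2⟩
  have hxD : x ∈ D := g0 ▸ gD 0 (by simp)
  have hx := bdist_pos ho hb hxD
  have h1 := pd_sub_le (mDensity_nonneg ho hb) ⟨K, hK⟩ ht.1 gD'
  rw [g0] at h1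
  refine h1.trans ?_
  rw [← log_len_right hK hx ht.1, ← intervalIntegral.integral_const_mul]
  refine intervalIntegral.integral_mono_on ht.1
    (rho_int (mDensity_cont ho hb) ⟨K, hK⟩ (by rwa [uIcc_of_le ht.1]))
    ((div_int hK ((continuous_const (y := bdist D x)).add (len_lip hK 0).continuous) ht.1 ?_).const_mul _) ?_
  · intro r hr
    have := len_nonneg (γ := γ) hr.1
    change 0 < bdist D x + len γ 0 r
    linarith
  · intro r hr
    have hp := bdist_pos ho hb (gD' r hr)
    have hl := len_nonneg (γ := γ) hr.1
    have h2 := hc r ⟨hr.1, hr.2.trans ht.2⟩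
    have h3 := bdist_lip D x (γ r)
    have h4 := dist_le_len hK hr.1
    rw [g0, norm_sub_rev] at h4
    have h5 : mDensity D (γ r) ≤ 2 * (1 + 2 * b) / (bdist D x + len γ 0 r) := by
      refine (mDensity_le ho hb (gD' r hr)).trans ?_
      rw [div_le_div_iff₀ hp (by linarith)]
      nlinarith
    calc _ ≤ 2 * (1 + 2 * b) / (bdist D x + len γ 0 r) * ‖deriv γ r‖ := by gcongr
      _ = _ := by ring

lemma carrot_cut {D : Set ℂ} {b L : ℝ} (hb1 : 1 ≤ b) {x z0 : ℂ} (hL : 0 ≤ L) (hL4 : L ≤ 4 * b * bdist D z0)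
    {γ : ℝ → ℂ} (hγ : IsRectPathIn D x z0 γ) (hc : ∀ t ∈ Icc (0:ℝ) 1, len γ 0 t ≤ b * bdist D (γ t)) :
    ∃ t ∈ Icc (0:ℝ) 1, len γ 0 t ≤ L ∧ ∀ u ∈ Icc t 1, L ≤ 4 * b * bdist D (γ u) := by
  obtain ⟨⟨K, hK⟩, g0, g1, gD⟩ := hγ
  rcases le_total (len γ 0 1) L with h | h
  · refine ⟨1, by simp, h, fun u hu => ?_⟩
    have : u = 1 := le_antisymm hu.2 hu.1
    rw [this, g1]; exact hL4
  · have hcont : ContinuousOn (fun r => len γ 0 r) (Icc 0 1) := (len_lip hK 0).continuous.continuousOn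
    obtain ⟨t, ht, et⟩ := intermediate_value_Icc (zero_le_one (α := ℝ)) hcont
      (show L ∈ Icc (len γ 0 0) (len γ 0 1) by rw [len_self]; exact ⟨hL, h⟩)
    simp only at et
    refine ⟨t, ht, et.le, fun u hu => ?_⟩
    have h1 := len_add hK 0 t u
    have h2 := len_nonneg (γ := γ) hu.1
    have h3 := hc u ⟨ht.1.trans hu.1, hu.2⟩
    have h4 : 0 ≤ bdist D (γ u) := infDist_nonneg
    nlinarith

lemma box_chain {D : Set ℂ} (ho : IsOpen D) (hb : Bornology.IsBounded D) (hcn : IsConnected D)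
    (hlog : ∀ f, f ∉ D → ∃ l : ℂ → ℂ, ContinuousOn l D ∧ ∀ z ∈ D, Complex.exp (l z) = z - f)
    {h : ℝ} (hh : 0 < h) (N : ℕ) {x x' y' : ℂ} {S T : Set ℂ} (hxD : x ∈ D)
    (hS : IsPreconnected S) (hSD : S ⊆ D)
    (hSb : ∀ z ∈ S, 10 * h ≤ bdist D z) (hxS : x' ∈ S) (hyS : y' ∈ S)
    (hT : IsPreconnected T) (hTD : T ⊆ D) (hTb : ∀ z ∈ T, ‖z - x‖ ≤ N * h) (hxT : x' ∈ T) (hyT : y' ∈ T) :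
    mDist D x' y' ≤ 2 + 2 * (2 * N + 21) ^ 2 := by
  obtain ⟨ρ, hρ⟩ := hb.exists_norm_le
  set m : ℕ := N + 10 with hm
  set o : ℂ := ⟨-(ρ + m * h), -(ρ + m * h)⟩ with hoo
  have hmh : (0:ℝ) ≤ m * h := by positivity
  have hoD : ∀ z ∈ D, o.re + m * h ≤ z.re ∧ o.im + m * h ≤ z.im := by
    intro z hz
    have h1 := hρ z hz
    have h2 := abs_le.1 ((Complex.abs_re_le_norm z).trans h1)
    have h3 := abs_le.1 ((Complex.abs_im_le_norm z).trans h1)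
    simp only [hoo]
    constructor <;> linarith [h2.1, h3.1]
  have hoD' : ∀ z ∈ D, o.re ≤ z.re ∧ o.im ≤ z.im := fun z hz => by
    have := hoD z hz
    constructor <;> linarith [this.1, this.2]
  set P := gp o h with hP
  have hpt : ∀ z ∈ S, ‖P (fl o h z) - z‖ ≤ 2 * h := fun z hz => by
    rw [norm_sub_rev]
    exact fl_dist hh (hoD' z (hSD hz)).1 (hoD' z (hSD hz)).2
  have hseg : ∀ z ∈ S, mDist D z (P (fl o h z)) ≤ 1 ∧ segment ℝ z (P (fl o h z)) ⊆ D := by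
    intro z hz
    have h1 := mDist_seg ho hb (r := 8 * h) (s := 2 * h) (hSD hz) (by linarith [hSb z hz]) (by linarith)
      (hpt z hz)
    refine ⟨h1.1.trans ?_, h1.2⟩
    have h2 := hpt z hz
    rw [div_mul_eq_mul_div, div_le_one (by linarith)]
    linarith
  have hPD : ∀ z ∈ S, P (fl o h z) ∈ D := fun z hz => (hseg z hz).2 (right_mem_segment ℝ _ _)
  have hchain := chain_of_preconn (D := D) (o := o) hh hS
    (fun z hz => far_of_bdist ho (hSD hz) (by linarith [hSb z hz])) (fun z hz => hoD' z (hSD hz)) hxS hyS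
  set n := fl o h x with hn
  have hx1 := fl_aux hh (hoD' x hxD).1
  have hx2 := fl_aux hh (hoD' x hxD).2
  have hn1 : m ≤ n.1 := by
    apply Nat.le_floor
    rw [le_div_iff₀ hh]
    linarith [(hoD x hxD).1]
  have hn2 : m ≤ n.2 := by
    apply Nat.le_floor
    rw [le_div_iff₀ hh]
    linarith [(hoD x hxD).2]
  have hx1 : o.re + h * n.1 ≤ x.re ∧ x.re ≤ o.re + h * n.1 + h := hx1
  have hx2 : o.im + h * n.2 ≤ x.im ∧ x.im ≤ o.im + h * n.2 + h := hx2
  have hball : ∀ z, ‖z - x‖ ≤ (N + 2) * h →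
      o.re + h * (n.1 - m : ℕ) + 7 * h ≤ z.re ∧ z.re ≤ o.re + h * (n.1 + m : ℕ) - 7 * h ∧
      o.im + h * (n.2 - m : ℕ) + 7 * h ≤ z.im ∧ z.im ≤ o.im + h * (n.2 + m : ℕ) - 7 * h := by
    intro z hz
    have h2 := abs_le.1 ((Complex.abs_re_le_norm (z - x)).trans hz)
    have h3 := abs_le.1 ((Complex.abs_im_le_norm (z - x)).trans hz)
    rw [Complex.sub_re] at h2
    rw [Complex.sub_im] at h3
    rw [Nat.cast_sub hn1, Nat.cast_sub hn2]
    push_cast [hm]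
    refine ⟨?_, ?_, ?_, ?_⟩ <;> nlinarith
  have hT' : IsPreconnected (T ∪ segment ℝ x' (P (fl o h x')) ∪ segment ℝ y' (P (fl o h y'))) := by
    refine IsPreconnected.union y' (Or.inl hyT) (left_mem_segment ℝ _ _) ?_ (convex_segment _ _).isPreconnected
    exact IsPreconnected.union x' hxT (left_mem_segment ℝ _ _) hT (convex_segment _ _).isPreconnected
  have hsegb : ∀ w ∈ S, w ∈ T → ∀ z ∈ segment ℝ w (P (fl o h w)), ‖z - x‖ ≤ (N + 2) * h := by
    intro w hw hwT z hz
    have h1 := seg_dist hz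
    have h2 := hpt w hw
    have h3 := hTb w hwT
    have h4 := norm_add_le (z - w) (w - x)
    rw [sub_add_sub_cancel] at h4
    linarith
  have hk := key hh hlog (i0 := n.1 - m) (i1 := n.1 + m) (j0 := n.2 - m) (j1 := n.2 + m) hT'
    (union_subset (union_subset hTD (hseg _ hxS).2) (hseg _ hyS).2)
    (Or.inl (Or.inr (right_mem_segment ℝ _ _))) (Or.inr (right_mem_segment ℝ _ _)) (by
      rintro z ((hz | hz) | hz)
      · apply hball; have := hTb z hz; linarith
      · exact hball _ (hsegb _ hxS hxT _ hz)
      · exact hball _ (hsegb _ hyS hyT _ hz)) hchain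
  have hmc := mDist_chain ho hb hcn hh (hPD _ hxS) (hPD _ hyS) hk
  have e1 : n.1 + m + 1 - (n.1 - m) = 2 * N + 21 := by omega
  have e2 : n.2 + m + 1 - (n.2 - m) = 2 * N + 21 := by omega
  rw [e1, e2] at hmc
  push_cast at hmc
  have tri := fun {a b c : ℂ} (ha : a ∈ D) (hb' : b ∈ D) (hc : c ∈ D) =>
    pd_triangle (mDensity_nonneg ho hb) (mDensity_cont ho hb) (rect_exists ho hb hcn) ha hb' hc
  have t1 : mDist D x' y' ≤ mDist D x' (P (fl o h x')) + mDist D (P (fl o h x')) y' :=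
    tri (hSD hxS) (hPD _ hxS) (hSD hyS)
  have t2 : mDist D (P (fl o h x')) y' ≤ mDist D (P (fl o h x')) (P (fl o h y')) + mDist D (P (fl o h y')) y' :=
    tri (hPD _ hxS) (hPD _ hyS) (hSD hyS)
  have t3 : mDist D (P (fl o h y')) y' = mDist D y' (P (fl o h y')) := pd_symm _ _
  have := (hseg _ hxS).1
  have := (hseg _ hyS).1
  nlinarith

lemma log_lb {a : ℝ} (ha : 0 ≤ a) : a / (1 + a) ≤ Real.log (1 + a) := by
  have := Real.one_sub_inv_le_log_of_pos (show 0 < 1 + a by linarith)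
  convert this using 1
  field_simp
  ring

lemma case_small {D : Set ℂ} (ho : IsOpen D) (hb : Bornology.IsBounded D) (hcn : IsConnected D) {x y : ℂ}
    (hx : x ∈ D) (hy : y ∈ D) (hl : innerDist D x y < bdist D x / 2) :
    mDist D x y ≤ 6 * Real.log (1 + innerDist D x y / bdist D x) := by
  have hp := bdist_pos ho hb hx
  have h1 := dist_le_innerDist (rect_exists ho hb hcn x hx y hy)
  have h2 := (mDist_seg ho hb (r := bdist D x / 2) (s := bdist D x / 2) hx (by linarith) (by linarith)
    (h1.trans hl.le)).1
  have h0 := innerDist_nonneg D x y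
  set a := innerDist D x y / bdist D x with ha
  have ha0 : 0 ≤ a := by positivity
  have ha2 : a ≤ 1 / 2 := by rw [ha, div_le_iff₀ hp]; linarith
  have h3 : mDist D x y ≤ 4 * a := by
    refine h2.trans ?_
    calc 2 / (bdist D x / 2) * ‖y - x‖ ≤ 2 / (bdist D x / 2) * innerDist D x y := by gcongr
      _ = 4 * a := by rw [ha]; field_simp; ring
  have h4 := log_lb ha0
  have h5 : 2 / 3 * a ≤ a / (1 + a) := by
    rw [le_div_iff₀ (by linarith)]; nlinarith
  linarith

lemma innerDist_symm (D : Set ℂ) (x y : ℂ) : innerDist D x y = innerDist D y x := pd_symm _ _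

lemma log_two {a : ℝ} (ha : 0 ≤ a) : Real.log (1 + 2 * a) ≤ 2 * Real.log (1 + a) := by
  have : (2:ℝ) * Real.log (1 + a) = Real.log ((1 + a) ^ 2) := by rw [Real.log_pow]; norm_num
  rw [this]
  apply Real.log_le_log <;> nlinarith

lemma case_large {D : Set ℂ} (ho : IsOpen D) (hb : Bornology.IsBounded D) (hcn : IsConnected D)
    (hlog : ∀ f, f ∉ D → ∃ l : ℂ → ℂ, ContinuousOn l D ∧ ∀ z ∈ D, Complex.exp (l z) = z - f)
    {b : ℝ} (hb1 : 1 ≤ b) {z0 : ℂ} (hz0 : z0 ∈ D) (H : ∀ x ∈ D, ∃ γ, IsRectPathIn D x z0 γ ∧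
      ∀ t ∈ Icc (0:ℝ) 1, len γ 0 t ≤ b * bdist D (γ t)) {x y : ℂ} (hx : x ∈ D) (hy : y ∈ D)
    (hl : 0 < innerDist D x y) :
    mDist D x y ≤ 4 * (1 + 2 * b) * (Real.log (1 + innerDist D x y / bdist D x) +
      Real.log (1 + innerDist D x y / bdist D y)) + (2 + 2 * (2 * (⌈120 * b⌉₊ : ℝ) + 21) ^ 2) := by
  obtain ⟨γ, hγ, cγ⟩ := H x hx
  obtain ⟨η, hη, cη⟩ := H y hy
  set l := innerDist D x y with hldef
  have hcomp := rect_exists ho hb hcn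
  have r0 := bdist_pos ho hb hz0
  have hL4 : 2 * l ≤ 4 * b * bdist D z0 := by
    have t : innerDist D x y ≤ innerDist D x z0 + innerDist D z0 y :=
      pd_triangle (by simp) continuousOn_const hcomp hx hz0 hy
    have a1 := innerDist_sub_le hγ.1 (zero_le_one (α := ℝ)) hγ.2.2.2
    have a2 := innerDist_sub_le hη.1 (zero_le_one (α := ℝ)) hη.2.2.2
    have a3 := cγ 1 (by simp)
    have a4 := cη 1 (by simp)
    rw [hγ.2.1, hγ.2.2.1] at a1
    rw [hη.2.1, hη.2.2.1] at a2
    rw [hγ.2.2.1] at a3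
    rw [hη.2.2.1] at a4
    rw [innerDist_symm D z0 y] at t
    linarith
  obtain ⟨t, ht, tL, tb⟩ := carrot_cut hb1 (by linarith) hL4 hγ cγ
  obtain ⟨s, hs, sL, sb⟩ := carrot_cut hb1 (by linarith) hL4 hη cη
  obtain ⟨β, hβ, βL⟩ := exists_near (ρ := fun _ => 1) (hcomp x hx y hy) (M := 2 * l)
    (by change innerDist D x y < _; linarith)
  rw [pathIntegral_one] at βL
  have m1 := carrot_m ho hb hb1 hγ cγ ht
  have m2 := carrot_m ho hb hb1 hη cη hs
  obtain ⟨⟨K, hK⟩, g0, g1, gD⟩ := hγ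
  obtain ⟨⟨K', hK'⟩, e0, e1, eD⟩ := hη
  obtain ⟨⟨K'', hK''⟩, b0, b1, bD⟩ := hβ
  have hbp : 0 < b := by linarith
  -- bounds on the curves
  have lt_of : ∀ {K : NNReal} {γ : ℝ → ℂ} (_ : LipschitzWith K γ) {t r : ℝ}, 0 ≤ r → r ≤ t →
      ‖γ r - γ 0‖ ≤ len γ 0 t := by
    intro K γ h t r hr hrt
    have h1 := dist_le_len h hr
    have h2 := len_add h 0 r t
    have h3 := len_nonneg (γ := γ) hrt
    linarith
  have hN := Nat.le_ceil (120 * b)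
  set N := ⌈120 * b⌉₊ with hNdef
  set h := 2 * l / (40 * b) with hh
  have hhp : 0 < h := by positivity
  have hNh : 6 * l ≤ N * h := by
    have : 120 * b * h = 6 * l := by rw [hh]; field_simp; ring
    nlinarith
  have h10 : ∀ d : ℝ, 2 * l ≤ 4 * b * d → 10 * h ≤ d := by
    intro d hd
    rw [hh, ← mul_div_assoc, div_le_iff₀ (by positivity)]
    linarith
  have hyx : ‖y - x‖ ≤ 2 * l := by
    have := lt_of hK'' zero_le_one (le_refl 1)
    rw [b0, b1] at this
    linarith
  have hbox := box_chain ho hb hcn hlog hhp N hx (x' := γ t) (y' := η s)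
    (S := γ '' Icc t 1 ∪ η '' Icc s 1) (T := γ '' Icc 0 t ∪ β '' Icc 0 1 ∪ η '' Icc 0 s)
    (IsPreconnected.union z0 ⟨1, ⟨ht.2, le_refl _⟩, g1⟩ ⟨1, ⟨hs.2, le_refl _⟩, e1⟩
      (isPreconnected_Icc.image _ hK.continuous.continuousOn)
      (isPreconnected_Icc.image _ hK'.continuous.continuousOn))
    (by
      rintro _ (⟨u, hu, rfl⟩ | ⟨u, hu, rfl⟩)
      · exact gD u ⟨ht.1.trans hu.1, hu.2⟩
      · exact eD u ⟨hs.1.trans hu.1, hu.2⟩)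
    (by
      rintro _ (⟨u, hu, rfl⟩ | ⟨u, hu, rfl⟩)
      · exact h10 _ (tb u hu)
      · exact h10 _ (sb u hu))
    (Or.inl ⟨t, ⟨le_refl _, ht.2⟩, rfl⟩) (Or.inr ⟨s, ⟨le_refl _, hs.2⟩, rfl⟩)
    (IsPreconnected.union y (Or.inr ⟨1, by simp, b1⟩) ⟨0, ⟨le_refl _, hs.1⟩, e0⟩
      (IsPreconnected.union x ⟨0, ⟨le_refl _, ht.1⟩, g0⟩ ⟨0, by simp, b0⟩
        (isPreconnected_Icc.image _ hK.continuous.continuousOn)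
        (isPreconnected_Icc.image _ hK''.continuous.continuousOn))
      (isPreconnected_Icc.image _ hK'.continuous.continuousOn))
    (by
      rintro _ ((⟨u, hu, rfl⟩ | ⟨u, hu, rfl⟩) | ⟨u, hu, rfl⟩)
      · exact gD u ⟨hu.1, hu.2.trans ht.2⟩
      · exact bD u hu
      · exact eD u ⟨hu.1, hu.2.trans hs.2⟩)
    (by
      rintro _ ((⟨u, hu, rfl⟩ | ⟨u, hu, rfl⟩) | ⟨u, hu, rfl⟩)
      · have := lt_of hK hu.1 hu.2
        rw [g0] at this
        linarith
      · have := lt_of hK'' hu.1 hu.2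
        rw [b0] at this
        linarith
      · have := lt_of hK' hu.1 hu.2
        rw [e0] at this
        have h4 := norm_add_le (η u - y) (y - x)
        rw [sub_add_sub_cancel] at h4
        linarith)
    (Or.inl (Or.inl ⟨t, ⟨ht.1, le_refl _⟩, rfl⟩)) (Or.inr ⟨s, ⟨hs.1, le_refl _⟩, rfl⟩)
  have logb : ∀ w ∈ D, ∀ q, 0 ≤ q → q ≤ 2 * l → 2 * (1 + 2 * b) * Real.log ((bdist D w + q) / bdist D w) ≤
      4 * (1 + 2 * b) * Real.log (1 + l / bdist D w) := by
    intro w hw q hq hql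
    have hp := bdist_pos ho hb hw
    have h1 : Real.log ((bdist D w + q) / bdist D w) ≤ Real.log (1 + 2 * (l / bdist D w)) := by
      apply Real.log_le_log (by positivity)
      rw [add_div, div_self hp.ne', ← mul_div_assoc]
      gcongr
    have h2 := log_two (show 0 ≤ l / bdist D w by positivity)
    have h3 : 2 * (1 + 2 * b) * Real.log ((bdist D w + q) / bdist D w) ≤
      2 * (1 + 2 * b) * (2 * Real.log (1 + l / bdist D w)) := by gcongr; exact h1.trans h2
    linarith
  have l1 := logb x hx _ (len_nonneg (γ := γ) ht.1) tL
  have l2 := logb y hy _ (len_nonneg (γ := η) hs.1) sL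
  have tri := fun {a b c : ℂ} (ha : a ∈ D) (hb' : b ∈ D) (hc : c ∈ D) =>
    pd_triangle (mDensity_nonneg ho hb) (mDensity_cont ho hb) (rect_exists ho hb hcn) ha hb' hc
  have t1 : mDist D x y ≤ mDist D x (γ t) + mDist D (γ t) y := tri hx (gD t ht) hy
  have t2 : mDist D (γ t) y ≤ mDist D (γ t) (η s) + mDist D (η s) y := tri (gD t ht) (eD s hs) hy
  have t3 : mDist D (η s) y = mDist D y (η s) := pd_symm _ _
  linarith

lemma le_of_john {D : Set ℂ} (ho : IsOpen D) (hcn : IsConnected D) (hsc : SimplyConnectedSpace D)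
    (hb : Bornology.IsBounded D) (hJ : IsJohnDisk D) :
    ∃ c₂ : ℝ, 1 ≤ c₂ ∧ ∀ z₁ ∈ D, ∀ z₂ ∈ D, mDist D z₁ z₂ ≤ c₂ * jDist' D z₁ z₂ := by
  have hlog : ∀ f, f ∉ D → ∃ l : ℂ → ℂ, ContinuousOn l D ∧ ∀ z ∈ D, Complex.exp (l z) = z - f := by
    intro f hf
    have hU : IsSimplyConnected D := hsc
    obtain ⟨l, h1, h2⟩ := Complex.exists_continuousOn_eqOn_exp_comp hU ho (g := fun z => z - f)
      (by fun_prop) (by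
        rintro ⟨z, hz, hzf⟩
        exact hf (sub_eq_zero.1 hzf ▸ hz))
    exact ⟨l, h1, fun z hz => h2 hz⟩
  obtain ⟨z0, hz0⟩ := hcn.nonempty
  obtain ⟨b, hb1, H⟩ := john_carrot ho hb hJ hz0
  set M : ℝ := 2 + 2 * (2 * (⌈120 * b⌉₊ : ℝ) + 21) ^ 2 with hM
  have hM0 : 0 ≤ M := by positivity
  refine ⟨12 + 8 * (1 + 2 * b) + 3 * M, by linarith, fun x hx y hy => ?_⟩
  have px := bdist_pos ho hb hx
  have py := bdist_pos ho hb hy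
  have l0 := innerDist_nonneg D x y
  have a0 : 0 ≤ innerDist D x y / bdist D x := by positivity
  have b0 : 0 ≤ innerDist D x y / bdist D y := by positivity
  have la := Real.log_nonneg (show 1 ≤ 1 + innerDist D x y / bdist D x by linarith)
  have lb := Real.log_nonneg (show 1 ≤ 1 + innerDist D x y / bdist D y by linarith)
  have hj : jDist' D x y = 1 / 2 * (Real.log (1 + innerDist D x y / bdist D x) +
      Real.log (1 + innerDist D x y / bdist D y)) := by
    rw [jDist', Real.log_mul (by positivity) (by positivity)]
  rw [hj]
  rcases lt_or_ge (innerDist D x y) (bdist D x / 2) with h1 | h1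
  · have := case_small ho hb hcn hx hy h1
    nlinarith [mul_nonneg hM0 la, mul_nonneg hM0 lb, mul_nonneg (show 0 ≤ b by linarith) la,
      mul_nonneg (show 0 ≤ b by linarith) lb]
  rcases lt_or_ge (innerDist D x y) (bdist D y / 2) with h2 | h2
  · have := case_small ho hb hcn hy hx (by rwa [innerDist_symm])
    rw [innerDist_symm D y x, show mDist D y x = mDist D x y from pd_symm _ _] at this
    nlinarith [mul_nonneg hM0 la, mul_nonneg hM0 lb, mul_nonneg (show 0 ≤ b by linarith) la,
      mul_nonneg (show 0 ≤ b by linarith) lb]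
  have hc := case_large ho hb hcn hlog hb1 hz0 H hx hy (by linarith)
  have q : ∀ d : ℝ, 0 < d → d / 2 ≤ innerDist D x y → 1 / 3 ≤ Real.log (1 + innerDist D x y / d) := by
    intro d hd h
    have : 1 / 2 ≤ innerDist D x y / d := by rw [le_div_iff₀ hd]; linarith
    refine le_trans ?_ (log_lb (by linarith))
    rw [le_div_iff₀ (by linarith)]
    linarith
  have q1 := q _ px h1
  have q2 := q _ py h2
  nlinarith [mul_le_mul_of_nonneg_left q1 hM0, mul_le_mul_of_nonneg_left q2 hM0]

/-- Proposition: characterization of John disks.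
A simply connected bounded domain $D ⊂ ℂ$ is a John disk iff there is $c_2 ≥ 1$ with
$m_D(z_1,z_2) ≤ c_2 j'_D(z_1,z_2)$ for all $z_1, z_2 ∈ D$. -/
theorem isJohnDisk_iff_mDist_le_jDist' (D : Set ℂ)
    (hDopen : IsOpen D) (hDconn : IsConnected D)
    (hDsc : SimplyConnectedSpace D)
    (hDbdd : Bornology.IsBounded D) (hDproper : D ≠ Set.univ) :
    IsJohnDisk D ↔
      ∃ c₂ : ℝ, 1 ≤ c₂ ∧ ∀ z₁ ∈ D, ∀ z₂ ∈ D, mDist D z₁ z₂ ≤ c₂ * jDist' D z₁ z₂ := by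
  constructor
  · exact le_of_john hDopen hDconn hDsc hDbdd
  · rintro ⟨c, hc, H⟩
    exact john_of_le hDopen hDconn hDbdd hc H
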